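/- Let d ≥ 3 and k ≥ 1 be integers. In the polynomial ring (ℤ/2)[x₁,x₂,x₃], consider the polynomial Q = (x₂+x₃) · (x₂·x₃·(x₁+x₂)·(x₁+x₃)·(x₂+x₃)·(x₁+x₂+x₃))^k (this equals (x₂+x₃)·(𝔓₃/x₁)^k, where 𝔓₃ = x₁x₂x₃(x₁+x₂)(x₁+x₃)(x₂+x₃)(x₁+x₂+x₃) is the Dickson polynomial in three variables). If Q does not belong to the ideal of (ℤ/2)[x₁,x₂,x₃] generated by x₁^d, x₂^d, x₃^d, then every mass distribution μ on ℝ^d admits an equipartition into (2k+1)×2×2 boxes by a collection of 2k parallel hyperplanes (orthogonal to some unit vector u, at levels t_1 < ... < t_{2k}) and two additional hyperplanes orthogonal to unit vectors v and w respectively, with u, v, w pairwise non-parallel: each of the 4(2k+1) regions {x : t_i < ⟨x,u⟩ < t_{i+1}} ∩ {x : ⟨x,v⟩ ≶ s₁} ∩ {x : ⟨x,w⟩ ≶ s₂} (with t_0 = -∞, t_{2k+1} = +∞ and all four sign choices) has μ-measure μ(ℝ^d)/(4(2k+1)). -/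

import Mathlib

open MeasureTheory

/-- The open slab between consecutive parallel hyperplanes orthogonal to `u`:
for `0 ≤ i ≤ n`, the region `{x : t i < ⟪x,u⟫ < t (i+1)}`, with the conventions
`t 0 = -∞` and `t (n+1) = +∞` (i.e. the corresponding inequality is dropped). -/
noncomputable def slab {d : ℕ} (u : EuclideanSpace ℝ (Fin d)) (t : ℕ → ℝ) (n i : ℕ) :
    Set (EuclideanSpace ℝ (Fin d)) :=
  {x | (1 ≤ i → t i < (inner ℝ x u : ℝ)) ∧ (i + 1 ≤ n → (inner ℝ x u : ℝ) < t (i + 1))}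

/-- The open halfspace below (`b = true`) or above (`b = false`) the hyperplane
orthogonal to `v` at level `s`. -/
def halfSp {d : ℕ} (v : EuclideanSpace ℝ (Fin d)) (s : ℝ) (b : Bool) :
    Set (EuclideanSpace ℝ (Fin d)) :=
  if b then {x | (inner ℝ x v : ℝ) < s} else {x | s < (inner ℝ x v : ℝ)}



namespace EqP

set_option linter.unusedSectionVars false

section Chains
variable {V W : Type*}

abbrev Ch (V : Type*) := List V →₀ ZMod 2

noncomputable def cone (p : V) : Ch V →ₗ[ZMod 2] Ch V := Finsupp.lmapDomain _ _ (List.cons p)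

noncomputable def push (T : V → W) : Ch V →ₗ[ZMod 2] Ch W := Finsupp.lmapDomain _ _ (List.map T)

noncomputable def bdL : List V → Ch V
  | [] => 0
  | x :: l => Finsupp.single l 1 + cone x (bdL l)

noncomputable def bd : Ch V →ₗ[ZMod 2] Ch V := Finsupp.linearCombination _ bdL

noncomputable def ev (f : List V → ZMod 2) : Ch V →ₗ[ZMod 2] ZMod 2 :=
  Finsupp.linearCombination _ f

noncomputable abbrev sg (l : List V) : Ch V := Finsupp.single l 1

lemma cone_sg (p : V) (l : List V) : cone p (sg l) = sg (p :: l) := by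
  simp [cone, sg, Finsupp.lmapDomain_apply, Finsupp.mapDomain_single]

lemma push_sg (T : V → W) (l : List V) : push T (sg l) = sg (l.map T) := by
  simp [push, sg, Finsupp.lmapDomain_apply, Finsupp.mapDomain_single]

lemma bd_sg (l : List V) : bd (sg l) = bdL l := by simp [bd, sg]

lemma ev_sg (f : List V → ZMod 2) (l : List V) : ev f (sg l) = f l := by simp [ev, sg]

lemma ch_add_self (c : Ch V) : c + c = 0 := by
  ext l; simp [CharTwo.add_self_eq_zero]

lemma hom_ext_sg {M : Type*} [AddCommMonoid M] [Module (ZMod 2) M] {f g : Ch V →ₗ[ZMod 2] M}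
    (h : ∀ l, f (sg l) = g (sg l)) : f = g := by
  apply Finsupp.lhom_ext'
  intro l
  apply LinearMap.ext_ring
  simpa using h l

/-- induction on supported chains -/
lemma supp_induction {P : List V → Prop} {Q : Ch V → Prop} {c : Ch V}
    (hc : ∀ l ∈ c.support, P l) (h0 : Q 0) (hadd : ∀ a b, Q a → Q b → Q (a + b))
    (hs : ∀ l, P l → Q (sg l)) : Q c := by
  classical
  have : c = ∑ l ∈ c.support, sg l := by
    conv_lhs => rw [← Finsupp.sum_single c]
    rw [Finsupp.sum]
    refine Finset.sum_congr rfl fun l hl => ?_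
    have h1 : c l ≠ 0 := Finsupp.mem_support_iff.1 hl
    have h2 : c l = 1 := by
      generalize c l = z at h1
      revert z; decide
    rw [h2]
  rw [this]
  exact Finset.sum_induction _ Q hadd h0 (fun l hl => hs l (hc l hl))

abbrev Spt (P : List V → Prop) : Submodule (ZMod 2) (Ch V) := Finsupp.supported _ _ {l | P l}

lemma spt_iff {P : List V → Prop} {c : Ch V} : c ∈ Spt P ↔ ∀ l ∈ c.support, P l := by
  rw [Finsupp.mem_supported]; rfl

lemma sg_spt {P : List V → Prop} {l : List V} (h : P l) : sg l ∈ Spt P :=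
  Finsupp.single_mem_supported _ _ h

lemma map_spt {P : List V → Prop} {M : Type*} [AddCommMonoid M] [Module (ZMod 2) M]
    (f : Ch V →ₗ[ZMod 2] M) (S : Submodule (ZMod 2) M)
    (h : ∀ l, P l → f (sg l) ∈ S) {c : Ch V} (hc : c ∈ Spt P) : f c ∈ S := by
  refine supp_induction (Q := fun c => f c ∈ S) (spt_iff.1 hc) (by simp) ?_ h
  intro a b ha hb
  rw [map_add]; exact S.add_mem ha hb

lemma eq_spt {P : List V → Prop} {M : Type*} [AddCommMonoid M] [Module (ZMod 2) M]
    (f g : Ch V →ₗ[ZMod 2] M)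
    (h : ∀ l, P l → f (sg l) = g (sg l)) {c : Ch V} (hc : c ∈ Spt P) : f c = g c := by
  refine supp_induction (Q := fun c => f c = g c) (spt_iff.1 hc) (by simp) ?_ h
  intro a b ha hb
  rw [map_add, map_add, ha, hb]

lemma spt_mono {P Q : List V → Prop} (h : ∀ l, P l → Q l) {c : Ch V} (hc : c ∈ Spt P) :
    c ∈ Spt Q := spt_iff.2 fun l hl => h l (spt_iff.1 hc l hl)

lemma bd_cone (p : V) (c : Ch V) : bd (cone p c) = c + cone p (bd c) := by
  have : bd ∘ₗ cone p = LinearMap.id + cone p ∘ₗ bd := by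
    apply hom_ext_sg
    intro l
    simp only [LinearMap.comp_apply, LinearMap.add_apply, cone_sg, bd_sg, LinearMap.id_apply]
    rfl
  exact LinearMap.congr_fun this c

lemma bd_bd (c : Ch V) : bd (bd c) = 0 := by
  have : (bd : Ch V →ₗ[ZMod 2] Ch V) ∘ₗ bd = 0 := by
    apply hom_ext_sg
    intro l
    simp only [LinearMap.comp_apply, bd_sg, LinearMap.zero_apply]
    induction l with
    | nil => simp [bdL]
    | cons x l ih =>
      rw [bdL, map_add, bd_sg, bd_cone, ih, map_zero, add_zero, ch_add_self]
  exact LinearMap.congr_fun this c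

lemma push_cone (T : V → W) (p : V) (c : Ch V) : push T (cone p c) = cone (T p) (push T c) := by
  have : push T ∘ₗ cone p = cone (T p) ∘ₗ push T := by
    apply hom_ext_sg
    intro l
    simp [cone_sg, push_sg]
  exact LinearMap.congr_fun this c

lemma push_bd (T : V → W) (c : Ch V) : push T (bd c) = bd (push T c) := by
  have : push T ∘ₗ bd = bd ∘ₗ push T := by
    apply hom_ext_sg
    intro l
    simp only [LinearMap.comp_apply, bd_sg, push_sg]
    induction l with
    | nil => simp [bdL]
    | cons x l ih => rw [bdL, map_add, push_sg, push_cone, ih]; rfl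
  exact LinearMap.congr_fun this c

lemma push_push {U : Type*} (T : V → W) (S : U → V) (c : Ch U) :
    push T (push S c) = push (T ∘ S) c := by
  have : push T ∘ₗ push S = push (T ∘ S) := by
    apply hom_ext_sg
    intro l
    simp [push_sg]
  exact LinearMap.congr_fun this c

lemma bdL_spt (l : List V) : bdL l ∈ Spt (fun t => t.length + 1 = l.length ∧ ∀ p ∈ t, p ∈ l) := by
  induction l with
  | nil => exact Submodule.zero_mem _
  | cons x l ih =>
    rw [bdL]
    refine Submodule.add_mem _ (sg_spt ⟨by simp, fun p hp => List.mem_cons_of_mem _ hp⟩) ?_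
    refine map_spt (cone x) _ ?_ ih
    rintro t ⟨h1, h2⟩
    rw [cone_sg]
    refine sg_spt ⟨by simp [h1], ?_⟩
    intro p hp
    rcases List.mem_cons.1 hp with h | h
    · simp [h]
    · exact List.mem_cons_of_mem _ (h2 p h)

/-! ### cup products -/

def cup : List (V → ZMod 2) → List V → ZMod 2
  | [], _ => 1
  | s :: ss, v :: w :: l => (s v + s w) * cup ss (w :: l)
  | _ :: _, _ => 0

lemma ev_cone (f : List V → ZMod 2) (p : V) (c : Ch V) :
    ev f (cone p c) = ev (fun l => f (p :: l)) c := by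
  have : ev f ∘ₗ cone p = ev (fun l => f (p :: l)) := by
    apply hom_ext_sg
    intro l
    simp [cone_sg, ev_sg]
  exact LinearMap.congr_fun this c

lemma ev_push (f : List V → ZMod 2) (T : W → V) (c : Ch W) :
    ev f (push T c) = ev (fun l => f (l.map T)) c := by
  have : ev f ∘ₗ push T = ev (fun l => f (l.map T)) := by
    apply hom_ext_sg
    intro l
    simp [push_sg, ev_sg]
  exact LinearMap.congr_fun this c

lemma ev_mul (a : ZMod 2) (f : List V → ZMod 2) (c : Ch V) :
    ev (fun l => a * f l) c = a * ev f c := by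
  have : ev (fun l => a * f l) = a • ev f := by
    apply hom_ext_sg
    intro l
    simp [ev_sg]
  rw [this]; rfl

lemma cup_cocycle (ss : List (V → ZMod 2)) : ∀ (l : List V), l.length = ss.length + 2 →
    ev (cup ss) (bdL l) = 0 := by
  induction ss with
  | nil =>
    intro l hl
    match l, hl with
    | [v, w], _ =>
      simp only [bdL, map_add, map_zero, add_zero, cone_sg, ev_sg, cup]
      decide
  | cons s ss ih =>
    intro l hl
    match l, hl with
    | v :: w :: x :: l, hl =>
      have hlen : (w :: x :: l).length = ss.length + 2 := by simp at hl ⊢; omega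
      have h1 := ih (w :: x :: l) hlen
      simp only [bdL, map_add, cone_sg, ev_sg, ev_cone, cup] at h1 ⊢
      rw [ev_mul]
      generalize s v = a, s w = b, s x = e at *
      generalize cup ss (x :: l) = A at *
      generalize cup ss (w :: l) = B at *
      generalize (ev fun l => cup ss (w :: x :: l)) (bdL l) = C at *
      revert a b e A B C; decide

lemma stokes (s : V → ZMod 2) (ss : List (V → ZMod 2)) {c : Ch V}
    (hc : c ∈ Spt (fun l => l.length = ss.length + 2)) :
    ev (cup (s :: ss)) c = ev (fun l => (l.head?.elim 0 s) * cup ss l) (bd c) := by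
  refine eq_spt (ev (cup (s :: ss))) (ev (fun l => (l.head?.elim 0 s) * cup ss l) ∘ₗ bd) ?_ hc
  intro l hl
  match l, hl with
  | v :: w :: l, hl =>
    have h1 := cup_cocycle ss _ hl
    rw [bdL] at h1
    rw [LinearMap.comp_apply, bd_sg, ev_sg, bdL, map_add, ev_sg, ev_cone]
    rw [map_add, ev_sg, ev_cone] at h1
    simp only [List.head?_cons, Option.elim, cup]
    rw [ev_mul]
    generalize s v = a, s w = b at *
    generalize cup ss (w :: l) = A at *
    generalize (ev fun l => cup ss (v :: l)) (bdL (w :: l)) = B at *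
    revert a b A B; decide

lemma cup_map (T : V → V) (ss : List (V → ZMod 2)) : ∀ (l : List V)
    (_ : ∀ s ∈ ss, ∃ a : ZMod 2, ∀ p ∈ l, s (T p) = s p + a), cup ss (l.map T) = cup ss l := by
  induction ss with
  | nil => intro l _; simp [cup]
  | cons s ss ih =>
    intro l h
    match l with
    | [] => rfl
    | [v] => rfl
    | v :: w :: l =>
      have := ih (w :: l) (fun s' hs' => by
        obtain ⟨a, ha⟩ := h s' (List.mem_cons_of_mem _ hs')
        exact ⟨a, fun p hp => ha p (List.mem_cons_of_mem _ hp)⟩)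
      obtain ⟨a, ha⟩ := h s (by simp)
      simp only [List.map_cons] at this ⊢
      simp only [cup]
      rw [this, ha v (by simp), ha w (by simp)]
      have : ∀ x y z : ZMod 2, x + z + (y + z) = x + y := by decide
      rw [this]

lemma cup_ne_zero (ss : List (V → ZMod 2)) : ∀ (l : List V), cup ss l ≠ 0 →
    ∀ s ∈ ss, ∃ p ∈ l, ∃ q ∈ l, s p ≠ s q := by
  induction ss with
  | nil => intro l _ s hs; simp at hs
  | cons s ss ih =>
    intro l h s' hs'
    match l, h with
    | v :: w :: l, h =>
      rw [cup] at h
      rcases List.mem_cons.1 hs' with rfl | h'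
      · refine ⟨v, by simp, w, by simp, fun e => h ?_⟩
        rw [e, CharTwo.add_self_eq_zero, zero_mul]
      · obtain ⟨p, hp, q, hq, h1⟩ := ih (w :: l) (right_ne_zero_of_mul h) s' h'
        exact ⟨p, List.mem_cons_of_mem _ hp, q, List.mem_cons_of_mem _ hq, h1⟩

end Chains

section Family
open MvPolynomial
variable {V ι I : Type*} [Fintype ι] [DecidableEq ι]

structure Fam (T : ι → V → V) (d : ℕ) (P : List V → Prop) (E : (ι →₀ ℕ) → Ch V) : Prop where
  spt : ∀ n : ι →₀ ℕ, (∀ j, n j < d) → E n ∈ Spt (fun l => l.length = ∑ j, n j + 1 ∧ P l)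
  bdE : ∀ n : ι →₀ ℕ, n ≠ 0 → bd (E n) = ∑ j, if j ∈ n.support then
    E (n - Finsupp.single j 1) + push (T j) (E (n - Finsupp.single j 1)) else 0
  zero : ev (fun _ => 1) (E 0) = 1

lemma sum_sub_single (n : ι →₀ ℕ) {j : ι} (hj : j ∈ n.support) :
    ∑ i, (n - Finsupp.single j 1 : ι →₀ ℕ) i + 1 = ∑ i, n i := by
  have h : n = (n - Finsupp.single j 1) + Finsupp.single j 1 := by
    rw [tsub_add_cancel_of_le]
    rw [Finsupp.single_le_iff]
    exact Nat.one_le_iff_ne_zero.2 (Finsupp.mem_support_iff.1 hj)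
  conv_rhs => rw [h]
  simp only [Finsupp.add_apply, Finset.sum_add_distrib]
  congr 1
  simp [Finsupp.single_apply]

lemma ev_fam {T : ι → V → V} {d : ℕ} {P : List V → Prop} {E : (ι →₀ ℕ) → Ch V}
    (hE : Fam T d P E) (s : I → V → ZMod 2) (χ : I → ι → ZMod 2)
    (hs : ∀ i j l, P l → ∀ p ∈ l, s i (T j p) = s i p + χ i j) (L : List I) :
    ∀ n : ι →₀ ℕ, (∀ j, n j < d) → L.length = ∑ j, n j →
    ev (cup (L.map s)) (E n) = coeff n (L.map (fun i => ∑ j, C (χ i j) * X j)).prod := by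
  induction L with
  | nil =>
    intro n hn hl
    have : n = 0 := by
      ext j
      have := hl.symm
      simp at this
      simp [this j]
    subst this
    simp only [List.map_nil, List.prod_nil]
    rw [coeff_zero_one]
    exact hE.zero
  | cons i L ih =>
    intro n hn hl
    have hn0 : n ≠ 0 := by
      rintro rfl
      simp at hl
    have hspt := hE.spt n hn
    rw [List.map_cons, stokes _ _ (spt_mono (fun l h => by
      rw [h.1, ← hl]; simp) hspt), hE.bdE n hn0, map_sum]
    rw [List.map_cons, List.prod_cons, Finset.sum_mul, coeff_sum]
    refine Finset.sum_congr rfl fun j _ => ?_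
    rw [mul_assoc, coeff_C_mul, coeff_X_mul']
    split_ifs with hj
    · have hlt : ∀ j', (n - Finsupp.single j 1 : ι →₀ ℕ) j' < d := fun j' =>
        lt_of_le_of_lt (by simp) (hn j')
      have hsum := sum_sub_single n hj
      rw [← ih (n - Finsupp.single j 1) hlt (by simp at hl; omega)]
      rw [map_add, ev_push]
      have hs2 := hE.spt _ hlt
      rw [← LinearMap.add_apply, ← ev_mul]
      refine eq_spt (_ + _) (ev _) ?_ hs2
      rintro l ⟨hl1, hP⟩
      rw [LinearMap.add_apply, ev_sg, ev_sg, ev_sg, cup_map]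
      · match l, hl1 with
        | v :: l, _ =>
          simp only [List.map_cons, List.head?_cons, Option.elim]
          rw [hs i j _ hP v (by simp)]
          generalize s i v = a
          generalize χ i j = b
          generalize cup _ _ = e
          revert a b e; decide
      · intro s' hs'
        obtain ⟨i', _, rfl⟩ := List.mem_map.1 hs'
        exact ⟨χ i' j, hs i' j l hP⟩
    · simp

end Family

section Sub
variable {V : Type*} [NormedAddCommGroup V] [NormedSpace ℝ V]

noncomputable def bary (l : List V) : V := (l.length : ℝ)⁻¹ • l.sum

noncomputable def sdN : ℕ → List V → Ch V
  | 0, _ => sg []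
  | n + 1, l => cone (bary l) (Finsupp.linearCombination (ZMod 2) (sdN n) (bdL l))

noncomputable def sd : Ch V →ₗ[ZMod 2] Ch V :=
  Finsupp.linearCombination _ (fun l => sdN l.length l)

lemma sd_nil : sd (sg ([] : List V)) = sg [] := by simp [sd, sg, sdN]

lemma sd_cons (x : V) (l : List V) :
    sd (sg (x :: l)) = cone (bary (x :: l)) (sd (bdL (x :: l))) := by
  have h1 : sd (sg (x :: l)) = sdN (l.length + 1) (x :: l) := by simp [sd, sg]
  rw [h1, sdN]
  congr 1
  refine eq_spt _ sd ?_ (bdL_spt (x :: l))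
  rintro t ⟨ht, -⟩
  simp only [List.length_cons, add_left_inj] at ht
  simp [sd, sg, ht]

lemma bd_sd_sg (n : ℕ) : ∀ l : List V, l.length = n → bd (sd (sg l)) = sd (bdL l) := by
  induction n with
  | zero =>
    intro l hl
    rw [List.length_eq_zero_iff] at hl
    subst hl
    rw [sd_nil, bd_sg, bdL, map_zero]
  | succ n ih =>
    intro l hl
    match l, hl with
    | x :: l, hl =>
      rw [sd_cons, bd_cone]
      have : bd (sd (bdL (x :: l))) = sd (bd (bdL (x :: l))) := by
        have h3 : ∀ t : List V, (t.length + 1 = (x :: l).length ∧ ∀ p ∈ t, p ∈ x :: l) →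
            ((bd : Ch V →ₗ[ZMod 2] Ch V) ∘ₗ sd) (sg t) = (sd ∘ₗ bd) (sg t) := by
          rintro t ⟨ht, -⟩
          rw [LinearMap.comp_apply, LinearMap.comp_apply, bd_sg]
          exact ih t (by omega)
        exact eq_spt ((bd : Ch V →ₗ[ZMod 2] Ch V) ∘ₗ sd) (sd ∘ₗ bd) h3 (bdL_spt (x :: l))
      rw [this, ← bd_sg, bd_bd, map_zero, map_zero, add_zero]

lemma bd_sd (c : Ch V) : bd (sd c) = sd (bd c) := by
  have : bd ∘ₗ sd = sd ∘ₗ (bd : Ch V →ₗ[ZMod 2] Ch V) := by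
    apply hom_ext_sg
    intro l
    simp only [LinearMap.comp_apply, bd_sg]
    exact bd_sd_sg _ l rfl
  exact LinearMap.congr_fun this c

lemma bary_map (T : V →ₗ[ℝ] V) (l : List V) : bary (l.map T) = T (bary l) := by
  simp [bary, map_list_sum]

lemma push_sd_sg (T : V →ₗ[ℝ] V) (n : ℕ) : ∀ l : List V, l.length = n →
    push T (sd (sg l)) = sd (push T (sg l)) := by
  induction n with
  | zero =>
    intro l hl
    rw [List.length_eq_zero_iff] at hl
    subst hl
    rw [sd_nil, push_sg, List.map_nil, sd_nil]
  | succ n ih =>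
    intro l hl
    match l, hl with
    | x :: l, hl =>
      rw [sd_cons, push_cone, push_sg, List.map_cons, sd_cons, ← List.map_cons, bary_map]
      congr 1
      rw [← bd_sg, ← bd_sg, ← push_sg, ← push_bd, bd_sg]
      have h3 : ∀ t : List V, (t.length + 1 = (x :: l).length ∧ ∀ p ∈ t, p ∈ x :: l) →
          (push T ∘ₗ sd) (sg t) = (sd ∘ₗ push T) (sg t) := by
        rintro t ⟨ht, -⟩
        exact ih t (by omega)
      exact eq_spt (push T ∘ₗ sd) (sd ∘ₗ push T) h3 (bdL_spt (x :: l))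

lemma push_sd (T : V →ₗ[ℝ] V) (c : Ch V) : push T (sd c) = sd (push T c) := by
  have : push T ∘ₗ sd = sd ∘ₗ push T := by
    apply hom_ext_sg
    intro l
    exact push_sd_sg T _ l rfl
  exact LinearMap.congr_fun this c

lemma bary_mem (l : List V) (hl : l ≠ []) {s : Set V} (hs : Convex ℝ s) (h : ∀ p ∈ l, p ∈ s) :
    bary l ∈ s := by
  have h0 : (0 : ℝ) < l.length := by
    exact_mod_cast List.length_pos_iff.2 hl
  have := hs.sum_mem (t := Finset.univ) (w := fun _ : Fin l.length => (l.length : ℝ)⁻¹)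
    (z := fun i => l.get i) (fun _ _ => by positivity) (by simp [h0.ne'])
    (fun i _ => h _ (List.get_mem _ _))
  rw [← Finset.smul_sum] at this
  have h2 : ∑ i : Fin l.length, l.get i = l.sum := by
    rw [← List.sum_ofFn, List.ofFn_get]
  rwa [h2] at this

lemma bary_dist (l : List V) {D : ℝ} (q : V) (hq : q ∈ l) (h : ∀ p ∈ l, dist p q ≤ D) :
    dist (bary l) q ≤ (1 - (l.length : ℝ)⁻¹) * D := by
  obtain ⟨a, b, rfl⟩ := List.append_of_mem hq
  have key : ∀ t : List V, (∀ p ∈ t, dist p q ≤ D) → ‖t.sum - (t.length : ℝ) • q‖ ≤ t.length * D := by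
    intro t
    induction t with
    | nil => simp
    | cons x t ih =>
      intro ht
      have h1 := ih (fun p hp => ht p (List.mem_cons_of_mem _ hp))
      have h2 := ht x (by simp)
      rw [dist_eq_norm] at h2
      have : (x :: t).sum - ((x :: t).length : ℝ) • q = (x - q) + (t.sum - (t.length : ℝ) • q) := by
        simp [add_smul]; abel
      rw [this]
      refine (norm_add_le _ _).trans ?_
      simp; linarith
  have ha := key a (fun p hp => h p (by simp [hp]))
  have hb := key b (fun p hp => h p (by simp [hp]))
  set N : ℝ := ((a ++ q :: b).length : ℝ) with hN
  have hN' : N = a.length + b.length + 1 := by simp [hN]; ring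
  have hpos : 0 < N := by rw [hN']; positivity
  have : bary (a ++ q :: b) - q = N⁻¹ • ((a.sum - (a.length : ℝ) • q) + (b.sum - (b.length : ℝ) • q)) := by
    rw [eq_inv_smul_iff₀ hpos.ne', smul_sub, bary, ← hN, smul_inv_smul₀ hpos.ne', hN']
    simp [add_smul]; abel
  rw [dist_eq_norm, this, norm_smul, norm_inv, Real.norm_of_nonneg hpos.le]
  have h3 := (norm_add_le _ _).trans (add_le_add ha hb)
  calc _ ≤ N⁻¹ * (a.length * D + b.length * D) := by gcongr
    _ = (1 - N⁻¹) * D := by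
      have : (a.length : ℝ) = N - b.length - 1 := by rw [hN']; ring
      rw [this]; field_simp; ring

lemma sd_spt (N : ℕ) {D : ℝ} (hD : 0 ≤ D) (n : ℕ) (hn : n ≤ N) : ∀ l : List V, l.length = n →
    (∀ p ∈ l, ∀ q ∈ l, dist p q ≤ D) →
    sd (sg l) ∈ Spt (fun t => t.length = l.length ∧ (∀ p ∈ t, p ∈ convexHull ℝ {x | x ∈ l}) ∧
      ∀ p ∈ t, ∀ q ∈ t, dist p q ≤ (1 - (N : ℝ)⁻¹) * D) := by
  induction n with
  | zero =>
    intro l hl _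
    rw [List.length_eq_zero_iff] at hl
    subst hl
    rw [sd_nil]
    exact sg_spt (by simp)
  | succ n ih =>
    intro l hl hdist
    match l, hl with
    | x :: l, hl =>
      rw [sd_cons]
      have h1 : sd (bdL (x :: l)) ∈ Spt (fun t => t.length = l.length ∧
          (∀ p ∈ t, p ∈ convexHull ℝ {y | y ∈ x :: l}) ∧
          ∀ p ∈ t, ∀ q ∈ t, dist p q ≤ (1 - (N : ℝ)⁻¹) * D) := by
        refine map_spt sd _ ?_ (bdL_spt (x :: l))
        rintro t ⟨ht, hsub⟩
        refine spt_mono ?_ (ih (by omega) t (by omega)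
          (fun p hp q hq => hdist p (hsub p hp) q (hsub q hq)))
        rintro r ⟨h1, h2, h3⟩
        refine ⟨by simp at ht; omega, fun p hp => ?_, h3⟩
        exact convexHull_mono (fun y hy => hsub y hy) (h2 p hp)
      refine map_spt (cone _) _ ?_ h1
      rintro t ⟨ht, hh, hd⟩
      rw [cone_sg]
      have hbm : bary (x :: l) ∈ convexHull ℝ {y | y ∈ x :: l} :=
        bary_mem _ (by simp) (convex_convexHull ℝ _) (fun p hp => subset_convexHull ℝ _ hp)
      have hbd : ∀ p ∈ convexHull ℝ {y | y ∈ x :: l},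
          dist p (bary (x :: l)) ≤ (1 - (N : ℝ)⁻¹) * D := by
        intro p hp
        have hc : Convex ℝ (Metric.closedBall (bary (x :: l)) ((1 - (N : ℝ)⁻¹) * D)) :=
          convex_closedBall _ _
        refine convexHull_min ?_ hc hp
        intro q hq
        rw [Metric.mem_closedBall, dist_comm]
        refine (bary_dist (x :: l) q hq (fun p hp => hdist p hp q hq)).trans ?_
        have : ((N : ℝ)⁻¹) ≤ ((x :: l).length : ℝ)⁻¹ := by
          apply inv_anti₀
          · simp; positivity
          · rw [hl]; exact_mod_cast hn
        nlinarith
      have h0 : 0 ≤ (1 - (N : ℝ)⁻¹) * D := le_trans dist_nonneg (hbd _ hbm)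
      refine sg_spt ⟨by simp [ht], ?_, ?_⟩
      · intro p hp
        rcases List.mem_cons.1 hp with rfl | h
        · exact hbm
        · exact hh p h
      · intro p hp q hq
        rcases List.mem_cons.1 hp with rfl | hp <;> rcases List.mem_cons.1 hq with rfl | hq
        · simpa using h0
        · rw [dist_comm]; exact hbd q (hh q hq)
        · exact hbd p (hh p hp)
        · exact hd p hp q hq

end Sub

section Iterate
variable {V ι : Type*} [NormedAddCommGroup V] [NormedSpace ℝ V] [Fintype ι] [DecidableEq ι]

def Small (K : Set V) (D : ℝ) (l : List V) : Prop :=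
  convexHull ℝ {x | x ∈ l} ⊆ K ∧ ∀ p ∈ l, ∀ q ∈ l, dist p q ≤ D

lemma fam_sd {T : ι → V →ₗ[ℝ] V} {d : ℕ} (hd : 0 < d) {K : Set V} {D : ℝ} (hD : 0 ≤ D)
    {E : (ι →₀ ℕ) → Ch V} (hE : Fam (fun j => T j) d (Small K D) E) :
    Fam (fun j => T j) d (Small K ((1 - ((Fintype.card ι * d + 1 : ℕ) : ℝ)⁻¹) * D))
      (fun n => sd (E n)) where
  spt n hn := by
    refine map_spt sd _ ?_ (hE.spt n hn)
    rintro l ⟨hl, hK, hdist⟩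
    have hle : ∑ j, n j + 1 ≤ Fintype.card ι * d + 1 := by
      have : ∑ j, n j ≤ ∑ _j : ι, d := Finset.sum_le_sum fun j _ => (hn j).le
      simpa using this
    refine spt_mono ?_ (sd_spt (Fintype.card ι * d + 1) hD _ hle l hl hdist)
    rintro t ⟨h1, h2, h3⟩
    exact ⟨h1.trans hl, (convexHull_min h2 (convex_convexHull ℝ _)).trans hK, h3⟩
  bdE n hn := by
    rw [bd_sd, hE.bdE n hn, map_sum]
    refine Finset.sum_congr rfl fun j _ => ?_
    split_ifs
    · rw [map_add, push_sd]
    · simp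
  zero := by
    refine Eq.trans ?_ hE.zero
    have h3 : ∀ t : List V, (t.length = ∑ j, (0 : ι →₀ ℕ) j + 1 ∧ Small K D t) →
        (ev (fun _ => 1) ∘ₗ sd) (sg t) = (ev (fun _ => 1)) (sg t) := by
      rintro t ⟨ht, -⟩
      simp only [Finsupp.coe_zero, Pi.zero_apply, Finset.sum_const_zero, zero_add] at ht
      obtain ⟨x, rfl⟩ := List.length_eq_one_iff.1 ht
      rw [LinearMap.comp_apply, sd_cons, ev_sg]
      simp [bdL, sd_nil, cone_sg, ev_sg]
    exact eq_spt (ev (fun _ => 1) ∘ₗ sd) (ev (fun _ => 1)) h3 (hE.spt 0 (fun _ => by simpa using hd))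

lemma fam_small {T : ι → V →ₗ[ℝ] V} {d : ℕ} (hd : 0 < d) {K : Set V} {D : ℝ} (hD : 0 ≤ D)
    {E : (ι →₀ ℕ) → Ch V} (hE : Fam (fun j => T j) d (Small K D) E) {ε : ℝ} (hε : 0 < ε) :
    ∃ E', Fam (fun j => T j) d (Small K ε) E' := by
  set r : ℝ := 1 - ((Fintype.card ι * d + 1 : ℕ) : ℝ)⁻¹ with hr
  have hpos : (0 : ℝ) < ((Fintype.card ι * d + 1 : ℕ) : ℝ)⁻¹ := by positivity
  have hle : ((Fintype.card ι * d + 1 : ℕ) : ℝ)⁻¹ ≤ 1 := by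
    apply inv_le_one_of_one_le₀
    exact_mod_cast Nat.le_add_left 1 _
  have h0 : 0 ≤ r := by linarith
  have h1 : r < 1 := by linarith
  have hiter : ∀ m : ℕ, ∃ E', Fam (fun j => T j) d (Small K (r ^ m * D)) E' := by
    intro m
    induction m with
    | zero => exact ⟨E, by simpa using hE⟩
    | succ m ih =>
      obtain ⟨E', hE'⟩ := ih
      have := fam_sd hd (by positivity) hE'
      rw [← hr, ← mul_assoc, ← pow_succ'] at this
      exact ⟨_, this⟩
  have ht : Filter.Tendsto (fun m : ℕ => r ^ m * D) Filter.atTop (nhds 0) := by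
    simpa using (tendsto_pow_atTop_nhds_zero_of_lt_one h0 h1).mul_const D
  obtain ⟨m, hm⟩ := (ht.eventually (gt_mem_nhds hε)).exists
  obtain ⟨E', hE'⟩ := hiter m
  refine ⟨E', ⟨fun n hn => spt_mono ?_ (hE'.spt n hn), hE'.bdE, hE'.zero⟩⟩
  rintro l ⟨a, b, c⟩
  exact ⟨a, b, fun p hp q hq => (c p hp q hq).trans hm.le⟩

end Iterate

section Coarse
variable {V ι : Type*} [Fintype ι] [DecidableEq ι]

noncomputable def E0 (T : ι → V → V) (b : (ι →₀ ℕ) → V) (n : ι →₀ ℕ) : Ch V :=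
  cone (b n) (if n = 0 then sg [] else ∑ j : ι, if h : j ∈ n.support then
    E0 T b (n - Finsupp.single j 1) + push (T j) (E0 T b (n - Finsupp.single j 1)) else 0)
termination_by ∑ j, n j
decreasing_by all_goals (classical have := sum_sub_single n h; omega)

noncomputable def Z0 (T : ι → V → V) (b : (ι →₀ ℕ) → V) (n : ι →₀ ℕ) : Ch V :=
  ∑ j : ι, if j ∈ n.support then
    E0 T b (n - Finsupp.single j 1) + push (T j) (E0 T b (n - Finsupp.single j 1)) else 0

lemma E0_eq (T : ι → V → V) (b : (ι →₀ ℕ) → V) (n : ι →₀ ℕ) :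
    E0 T b n = cone (b n) (if n = 0 then sg [] else Z0 T b n) := by
  rw [E0]; rfl

lemma sum_sum_symm (a : ι → ι → Ch V) (h1 : ∀ i j, a i j = a j i) (h2 : ∀ i, a i i = 0) :
    ∑ i, ∑ j, a i j = 0 := by
  rw [← Finset.sum_product']
  refine Finset.sum_involution (fun x _ => (x.2, x.1)) ?_ ?_ ?_ ?_
  · rintro ⟨i, j⟩ _
    simp only
    rw [h1 j i, ch_add_self]
  · rintro ⟨i, j⟩ _ h e
    simp only [Prod.mk.injEq] at e
    apply h
    simp only
    rw [e.1, h2]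
  · simp
  · simp

lemma bd_E0 (T : ι → V → V) (b : (ι →₀ ℕ) → V) (hT : ∀ j, T j ∘ T j = id)
    (hTT : ∀ i j, T i ∘ T j = T j ∘ T i) (N : ℕ) : ∀ n : ι →₀ ℕ, ∑ j, n j = N →
    bd (E0 T b n) = Z0 T b n + if n = 0 then sg [] else 0 := by
  induction N using Nat.strong_induction_on with
  | _ N ih =>
  intro n hN
  rw [E0_eq, bd_cone]
  by_cases hn : n = 0
  · subst hn
    simp [Z0, bdL, bd_sg]
  simp only [hn, if_false, add_zero]
  suffices h : bd (Z0 T b n) = 0 by rw [h, map_zero, add_zero]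
  have key : bd (Z0 T b n) = ∑ j, ∑ l, if j ∈ n.support ∧ l ∈ (n - Finsupp.single j 1).support then
      (E0 T b (n - Finsupp.single j 1 - Finsupp.single l 1)
        + push (T l) (E0 T b (n - Finsupp.single j 1 - Finsupp.single l 1)))
      + push (T j) (E0 T b (n - Finsupp.single j 1 - Finsupp.single l 1)
        + push (T l) (E0 T b (n - Finsupp.single j 1 - Finsupp.single l 1))) else 0 := by
    rw [Z0, map_sum]
    refine Finset.sum_congr rfl fun j _ => ?_
    by_cases hj : j ∈ n.support
    · have hlt := sum_sub_single n hj
      simp only [hj, if_true, true_and]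
      rw [map_add, ← push_bd, ih _ (by omega) (n - Finsupp.single j 1) rfl, map_add, Z0]
      have h0 : ∀ z : Ch V, z = (if n - Finsupp.single j 1 = 0 then sg [] else 0) →
        z + push (T j) z = 0 := by
        rintro z rfl
        split_ifs
        · rw [push_sg, List.map_nil, ch_add_self]
        · simp
      have h0' := h0 _ rfl
      rw [add_add_add_comm, h0', add_zero, map_sum, ← Finset.sum_add_distrib]
      refine Finset.sum_congr rfl fun l _ => ?_
      split_ifs <;> simp
    · simp [hj]
  rw [key]
  apply sum_sum_symm
  · intro i j
    by_cases hij : i = j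
    · subst hij; rfl
    have hc : (i ∈ n.support ∧ j ∈ (n - Finsupp.single i 1).support) ↔
        (j ∈ n.support ∧ i ∈ (n - Finsupp.single j 1).support) := by
      simp [hij, Ne.symm hij, and_comm]
    rw [if_congr hc rfl rfl]
    split_ifs
    · rw [tsub_right_comm]
      simp only [map_add, push_push]
      rw [hTT i j]
      abel
    · rfl
  · intro i
    split_ifs
    · simp only [map_add, push_push, hT]
      have hid : ∀ c : Ch V, push id c = c := by
        intro c; simp [push]
      rw [hid]
      generalize E0 T b _ = A
      have : A + push (T i) A + (push (T i) A + A) = (A + A) + (push (T i) A + push (T i) A) := by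
        abel
      rw [this, ch_add_self, ch_add_self, add_zero]
    · rfl

end Coarse

section Sphere
variable {ι : Type*} [Fintype ι] [DecidableEq ι]

abbrev Eu (d : ℕ) := EuclideanSpace ℝ (Fin d)

noncomputable def basisV (d m : ℕ) : Eu d := if h : m < d then EuclideanSpace.single ⟨m, h⟩ 1 else 0

lemma basisV_apply {d m : ℕ} (h : m < d) (i : Fin d) :
    basisV d m i = if (i : ℕ) = m then 1 else 0 := by
  simp [basisV, h, Fin.ext_iff]

def QC {d : ℕ} (m : ℕ) (t : List (Eu d)) : Prop :=
  ∃ ε : Fin d → ℝ, (∀ i, ε i = 1 ∨ ε i = -1) ∧ (∀ i : Fin d, (i : ℕ) = m → ε i = 1) ∧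
    ∀ p ∈ t, (∀ i, 0 ≤ ε i * p i) ∧ ∑ i, ε i * p i = 1 ∧ ∀ i : Fin d, m < i → p i = 0

lemma QC_basis {d m : ℕ} (h : m < d) (ε : Fin d → ℝ) (hε : ∀ i : Fin d, (i : ℕ) = m → ε i = 1) :
    (∀ i, 0 ≤ ε i * basisV d m i) ∧ ∑ i, ε i * basisV d m i = 1 ∧
      ∀ i : Fin d, m < i → basisV d m i = 0 := by
  refine ⟨?_, ?_, ?_⟩
  · intro i
    rw [basisV_apply h]
    split_ifs with h1
    · rw [hε i h1]; norm_num
    · simp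
  · rw [Finset.sum_eq_single ⟨m, h⟩]
    · rw [basisV_apply h, hε _ rfl]; simp
    · intro i _ hi
      rw [basisV_apply h, if_neg (fun e => hi (Fin.ext e)), mul_zero]
    · simp
  · intro i hi
    rw [basisV_apply h, if_neg (by omega)]

lemma QC_zero {d : ℕ} (m : ℕ) (h : m < d) : QC (d := d) m [basisV d m] := by
  refine ⟨fun _ => 1, by simp, by simp, ?_⟩
  intro p hp
  rw [List.mem_singleton] at hp
  subst hp
  exact QC_basis h _ (by simp)

lemma QC_same {d m : ℕ} (h : m < d) {t : List (Eu d)} (ht : QC m t) : QC m (basisV d m :: t) := by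
  obtain ⟨ε, h1, h2, h3⟩ := ht
  refine ⟨ε, h1, h2, ?_⟩
  intro p hp
  rcases List.mem_cons.1 hp with rfl | hp
  · exact QC_basis h _ h2
  · exact h3 p hp

lemma QC_succ {d m : ℕ} (h : m + 1 < d) {t : List (Eu d)} (ht : QC m t) :
    QC (m + 1) (basisV d (m + 1) :: t) := by
  obtain ⟨ε, h1, h2, h3⟩ := ht
  refine ⟨fun i => if (i : ℕ) = m + 1 then 1 else ε i, ?_, ?_, ?_⟩
  · intro i; dsimp only; split_ifs
    · simp
    · exact h1 i
  · intro i hi; simp [hi]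
  intro p hp
  rcases List.mem_cons.1 hp with rfl | hp
  · exact QC_basis h _ (by intro i hi; simp [hi])
  · obtain ⟨a, b, c⟩ := h3 p hp
    have e : ∀ i : Fin d, (if (i : ℕ) = m + 1 then 1 else ε i) * p i = ε i * p i := by
      intro i
      split_ifs with hi
      · rw [c i (by omega)]; simp
      · rfl
    refine ⟨fun i => by rw [e]; exact a i, ?_, fun i hi => c i (by omega)⟩
    simp only [e, b]

lemma QC_succ_neg {d m : ℕ} (h : m + 1 < d) {t : List (Eu d)} (ht : QC m t) :
    QC (m + 1) (basisV d (m + 1) :: t.map (fun x => -x)) := by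
  obtain ⟨ε, h1, h2, h3⟩ := ht
  refine ⟨fun i => if (i : ℕ) = m + 1 then 1 else - ε i, ?_, ?_, ?_⟩
  · intro i; dsimp only; split_ifs
    · simp
    · rcases h1 i with h | h <;> simp [h]
  · intro i hi; simp [hi]
  intro p hp
  rcases List.mem_cons.1 hp with rfl | hp
  · exact QC_basis h _ (by intro i hi; simp [hi])
  · obtain ⟨p, hp', rfl⟩ := List.mem_map.1 hp
    obtain ⟨a, b, c⟩ := h3 p hp'
    have e : ∀ i : Fin d, (if (i : ℕ) = m + 1 then 1 else - ε i) * (-p) i = ε i * p i := by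
      intro i
      split_ifs with hi
      · simp [c i (by omega)]
      · simp
    refine ⟨fun i => by rw [e]; exact a i, ?_, fun i hi => by simp [c i (by omega)]⟩
    simp only [e, b]

lemma QC_hull {d m : ℕ} {t : List (Eu d)} (ht : QC m t) :
    convexHull ℝ {x | x ∈ t} ⊆ {x | ∑ i, |x i| = 1} := by
  obtain ⟨ε, h1, h2, h3⟩ := ht
  have hc : Convex ℝ {p : Eu d | (∀ i, 0 ≤ ε i * p i) ∧ ∑ i, ε i * p i = 1} := by
    rintro x ⟨hx1, hx2⟩ y ⟨hy1, hy2⟩ a b ha hb hab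
    have e : ∀ i, ε i * (a • x + b • y) i = a * (ε i * x i) + b * (ε i * y i) := by
      intro i; simp; ring
    refine ⟨fun i => ?_, ?_⟩
    · rw [e]
      exact add_nonneg (mul_nonneg ha (hx1 i)) (mul_nonneg hb (hy1 i))
    · simp only [e]
      rw [Finset.sum_add_distrib, ← Finset.mul_sum, ← Finset.mul_sum, hx2, hy2]; linarith
  intro x hx
  have := convexHull_min (s := {x | x ∈ t}) (t := {p : Eu d | (∀ i, 0 ≤ ε i * p i) ∧ ∑ i, ε i * p i = 1}) (fun p hp => ⟨(h3 p hp).1, (h3 p hp).2.1⟩) hc hx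
  rw [Set.mem_ofPred_eq, ← this.2]
  refine Finset.sum_congr rfl fun i _ => ?_
  have h4 := this.1 i
  rcases h1 i with h | h
  · rw [h] at h4 ⊢; rw [abs_of_nonneg (by linarith)]; ring
  · rw [h] at h4 ⊢; rw [abs_of_nonpos (by linarith)]; ring

noncomputable def flip (d : ℕ) (j : ι) : (ι → Eu d) →ₗ[ℝ] (ι → Eu d) :=
  LinearMap.pi (fun i => if i = j then -LinearMap.proj i else LinearMap.proj i)

lemma flip_apply (d : ℕ) (j i : ι) (x : ι → Eu d) :
    flip d j x i = if i = j then - x i else x i := by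
  simp only [flip, LinearMap.pi_apply]
  split_ifs <;> rfl

def KK (d : ℕ) : Set (ι → Eu d) := {x | ∀ j, ∑ i, |x j i| = 1}

lemma E0_spt (d : ℕ) (N : ℕ) : ∀ n : ι →₀ ℕ, ∑ j, n j = N → (∀ j, n j < d) →
    E0 (fun j => flip d j) (fun n j => basisV d (n j)) n ∈
      Spt (fun l => l.length = ∑ j, n j + 1 ∧ ∀ j, QC (n j) (l.map (fun x => x j))) := by
  induction N using Nat.strong_induction_on with
  | _ N ih =>
  intro n hN hn
  rw [E0_eq]
  split_ifs with h0
  · subst h0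
    rw [cone_sg]
    refine sg_spt ⟨by simp, fun j => ?_⟩
    exact QC_zero _ (hn j)
  · rw [Z0, map_sum]
    refine Submodule.sum_mem _ fun j0 _ => ?_
    split_ifs with hj
    · have hsum := sum_sub_single n hj
      have hpos : n j0 ≠ 0 := Finsupp.mem_support_iff.1 hj
      have hih := ih _ (by omega) (n - Finsupp.single j0 1) rfl
        (fun j' => lt_of_le_of_lt (by simp) (hn j'))
      rw [map_add]
      have hval : ∀ j, j ≠ j0 → (n - Finsupp.single j0 1 : ι →₀ ℕ) j = n j := by
        intro j h; simp [Ne.symm h]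
      have hval0 : (n - Finsupp.single j0 1 : ι →₀ ℕ) j0 + 1 = n j0 := by
        simp; omega
      refine Submodule.add_mem _ (map_spt (cone _) _ ?_ hih)
        (map_spt (cone _ ∘ₗ push _) _ ?_ hih)
      · rintro l ⟨h1, h2⟩
        rw [cone_sg]
        refine sg_spt ⟨by rw [List.length_cons]; omega, fun j => ?_⟩
        have := h2 j
        rw [List.map_cons]
        by_cases hjj : j = j0
        · subst hjj
          have h5 := QC_succ (by rw [hval0]; exact hn j) this
          rw [hval0] at h5
          exact h5
        · rw [hval j hjj] at this
          exact QC_same (hn j) this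
      · rintro l ⟨h1, h2⟩
        rw [LinearMap.comp_apply, push_sg, cone_sg]
        refine sg_spt ⟨by rw [List.length_cons, List.length_map]; omega, fun j => ?_⟩
        have := h2 j
        rw [List.map_cons, List.map_map]
        by_cases hjj : j = j0
        · subst hjj
          have h5 := QC_succ_neg (by rw [hval0]; exact hn j) this
          rw [List.map_map, hval0] at h5
          convert h5 using 3
          funext x
          simp [flip_apply]
        · rw [hval j hjj] at this
          have h5 := QC_same (hn j) this
          convert h5 using 3
          funext x
          simp [flip_apply, hjj]
    · rw [map_zero]; exact Submodule.zero_mem _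

lemma KK_norm {d : ℕ} {x : ι → Eu d} (hx : x ∈ KK d) : ‖x‖ ≤ 1 := by
  rw [pi_norm_le_iff_of_nonneg zero_le_one]
  intro j
  rw [EuclideanSpace.norm_eq]
  refine Real.sqrt_le_one.2 ?_
  rw [← one_pow 2, ← hx j]
  simp only [Real.norm_eq_abs]
  exact Finset.sum_sq_le_sq_sum_of_nonneg fun i _ => abs_nonneg _

lemma KK_compact (d : ℕ) : IsCompact (KK d : Set (ι → Eu d)) := by
  apply Metric.isCompact_of_isClosed_isBounded
  · have : (KK d : Set (ι → Eu d)) = ⋂ j, {x | ∑ i, |x j i| = 1} := by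
      ext x; simp [KK]
    rw [this]
    refine isClosed_iInter fun j => isClosed_eq ?_ continuous_const
    fun_prop
  · rw [isBounded_iff_forall_norm_le]
    exact ⟨1, fun x hx => KK_norm hx⟩

lemma fam_exists (d : ℕ) (hd : 0 < d) {ε : ℝ} (hε : 0 < ε) :
    ∃ E, Fam (fun j : ι => flip d j) d (Small (KK d) ε) E := by
  refine fam_small (D := 2) (E := E0 (fun j => flip d j) (fun n j => basisV d (n j))) hd (by norm_num)
    ⟨?_, ?_, ?_⟩ hε
  · intro n hn
    refine spt_mono ?_ (E0_spt d _ n rfl hn)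
    rintro l ⟨h1, h2⟩
    have hK : convexHull ℝ {x | x ∈ l} ⊆ KK d := by
      intro x hx j
      refine QC_hull (h2 j) ?_
      have := Set.mem_image_of_mem (LinearMap.proj (R := ℝ) (φ := fun _ : ι => Eu d) j) hx
      rw [LinearMap.image_convexHull] at this
      have e : {y | y ∈ l.map (fun x => x j)} =
          (LinearMap.proj (R := ℝ) (φ := fun _ : ι => Eu d) j) '' {x | x ∈ l} := by
        ext y; simp
      rw [e]; exact this
    refine ⟨h1, hK, ?_⟩
    intro p hp q hq
    have a := KK_norm (hK (subset_convexHull ℝ _ hp))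
    have b := KK_norm (hK (subset_convexHull ℝ _ hq))
    rw [dist_eq_norm]
    linarith [norm_sub_le p q]
  · intro n hn
    rw [bd_E0 _ _ _ _ _ n rfl]
    · simp [hn, Z0]
    · intro j; funext x i
      simp only [Function.comp, flip_apply]
      split_ifs <;> simp
    · intro i j; funext x l
      simp only [Function.comp, flip_apply]
      split_ifs <;> simp
  · rw [E0_eq, if_pos rfl, cone_sg, ev_sg]

end Sphere

section BU
open MvPolynomial
variable {ι I : Type*} [Fintype ι] [DecidableEq ι] [Fintype I]

open Classical in
noncomputable def tau {E : Type*} [Neg E] (y : E) : ZMod 2 :=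
  if WellOrderingRel y (-y) then 1 else 0

lemma tau_neg {E : Type*} [AddCommGroup E] [Module ℝ E] (y : E) (hy : y ≠ 0) :
    tau (-y) = tau y + 1 := by
  have hne : y ≠ -y := by
    intro h
    have h1 : (2 : ℝ) • y = 0 := by
      rw [two_smul]; nth_rewrite 1 [h]; simp
    exact hy ((smul_eq_zero.1 h1).resolve_left two_ne_zero)
  unfold tau
  rw [neg_neg]
  rcases trichotomous_of WellOrderingRel y (-y) with h | h | h
  · have h' : ¬ WellOrderingRel (-y) y := asymm h
    rw [if_pos h, if_neg h']; decide
  · exact absurd h hne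
  · have h' : ¬ WellOrderingRel y (-y) := asymm h
    rw [if_pos h, if_neg h']; decide

lemma zmod2_cases (a : ZMod 2) : a = 0 ∨ a = 1 := by revert a; decide

noncomputable def sgnf {d : ℕ} (χ : I → ι → ZMod 2) (F : I → (ι → Eu d) → ℝ) (i : I)
    (x : ι → Eu d) : ZMod 2 :=
  if F i x < 0 then 1 else if 0 < F i x then 0 else ∑ j, χ i j * tau (x j)

lemma sgnf_flip {d : ℕ} (χ : I → ι → ZMod 2) (F : I → (ι → Eu d) → ℝ) (i : I) (j : ι)
    (x : ι → Eu d) (hx : ∀ j, x j ≠ 0)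
    (h : F i (flip d j x) = if χ i j = 0 then F i x else - F i x) :
    sgnf χ F i (flip d j x) = sgnf χ F i x + χ i j := by
  have hsum : ∑ l, χ i l * tau (flip d j x l) = ∑ l, χ i l * tau (x l) + χ i j := by
    have : ∀ l, χ i l * tau (flip d j x l) = χ i l * tau (x l) + if l = j then χ i j else 0 := by
      intro l
      rw [flip_apply]
      split_ifs with hl
      · subst hl; rw [tau_neg _ (hx l)]; ring
      · simp
    simp only [this, Finset.sum_add_distrib]
    simp
  unfold sgnf
  rw [h, hsum]
  rcases zmod2_cases (χ i j) with h0 | h0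
  · simp [h0]
  · simp only [h0, one_ne_zero, if_false, Left.neg_neg_iff, Left.neg_pos_iff]
    rcases lt_trichotomy (F i x) 0 with h1 | h1 | h1
    · simp only [h1, not_lt_of_gt h1, if_true, if_false]; decide
    · simp [h1]
    · simp only [h1, not_lt_of_gt h1, if_true, if_false]; decide

lemma sgnf_ne {d : ℕ} (χ : I → ι → ZMod 2) (F : I → (ι → Eu d) → ℝ) (i : I)
    (x y : ι → Eu d) (h : sgnf χ F i x ≠ sgnf χ F i y) : |F i x| ≤ |F i x - F i y| := by
  by_contra hc
  push Not at hc
  apply h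
  unfold sgnf
  rcases lt_trichotomy (F i x) 0 with h1 | h1 | h1
  · have h2 : F i y < 0 := by
      rw [abs_of_neg h1] at hc
      linarith [neg_abs_le (F i x - F i y)]
    rw [if_pos h1, if_pos h2]
  · rw [h1, abs_zero] at hc
    exact absurd hc (not_lt_of_ge (abs_nonneg _))
  · have h2 : 0 < F i y := by
      rw [abs_of_pos h1] at hc
      linarith [le_abs_self (F i x - F i y)]
    rw [if_neg (not_lt_of_gt h1), if_neg (not_lt_of_gt h2), if_pos h1, if_pos h2]

theorem borsuk_ulam (d : ℕ) (χ : I → ι → ZMod 2) (F : I → (ι → Eu d) → ℝ)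
    (hF : ∀ i, ContinuousOn (F i) {x | ∀ j, x j ≠ 0})
    (heq : ∀ i j x, (∀ j, x j ≠ 0) → F i (flip d j x) = if χ i j = 0 then F i x else - F i x)
    (hd : 0 < d) (n : ι →₀ ℕ) (hn : ∀ j, n j < d)
    (hc : coeff n (∏ i, ∑ j, C (χ i j) * X j) ≠ 0) :
    ∃ x : ι → Eu d, (∀ j, x j ≠ 0) ∧ ∀ i, F i x = 0 := by
  classical
  have hdeg : Fintype.card I = ∑ j, n j := by
    have hh : (∏ i, ∑ j, C (χ i j) * X j : MvPolynomial ι (ZMod 2)).IsHomogeneous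
        (∑ _i : I, 1) := by
      apply IsHomogeneous.prod
      intro i _
      apply IsHomogeneous.sum
      intro j _
      have := (isHomogeneous_C ι (χ i j)).mul (isHomogeneous_X (ZMod 2) j)
      simpa using this
    by_contra hne
    apply hc
    apply hh.coeff_eq_zero
    rw [Finsupp.degree_eq_sum]
    simpa using fun h => hne h.symm
  have hK0 : ∀ x ∈ (KK d : Set (ι → Eu d)), ∀ j, x j ≠ 0 := by
    intro x hx j h0
    have := hx j
    rw [h0] at this
    simp at this
  have hFK : ContinuousOn (fun x i => F i x) (KK d : Set (ι → Eu d)) :=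
    continuousOn_pi.2 fun i => (hF i).mono hK0
  have huc := (KK_compact d).uniformContinuousOn_of_continuous hFK
  rw [Metric.uniformContinuousOn_iff] at huc
  have key : ∀ δ > 0, ∃ x ∈ (KK d : Set (ι → Eu d)), ∀ i, |F i x| ≤ 2 * δ := by
    intro δ hδ
    obtain ⟨η, hη, hun⟩ := huc δ hδ
    obtain ⟨E, hE⟩ := fam_exists (ι := ι) d hd (half_pos hη)
    have hsub : ∀ l : List (ι → Eu d), Small (KK d) (η / 2) l → ∀ p ∈ l, p ∈ (KK d : Set (ι → Eu d)) :=
      fun l hl p hp => hl.1 (subset_convexHull ℝ _ hp)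
    have hev := ev_fam hE (sgnf χ F) χ (fun i j l hl p hp =>
      sgnf_flip χ F i j p (hK0 p (hsub l hl p hp)) (heq i j p (hK0 p (hsub l hl p hp))))
      Finset.univ.toList n hn (by rw [Finset.length_toList, Finset.card_univ, hdeg])
    rw [Finset.prod_map_toList] at hev
    rw [← hev] at hc
    have hex : ∃ l : List (ι → Eu d), (l.length = ∑ j, n j + 1 ∧ Small (KK d) (η / 2) l) ∧
        cup (Finset.univ.toList.map (sgnf χ F)) l ≠ 0 := by
      by_contra hno
      push Not at hno
      apply hc
      refine eq_spt (ev _) 0 ?_ (hE.spt n hn)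
      intro l hl
      rw [ev_sg, hno l hl]; rfl
    obtain ⟨l, ⟨hl1, hl2⟩, hl3⟩ := hex
    match l, hl1 with
    | x :: l, _ =>
      refine ⟨x, hsub _ hl2 x (by simp), fun i => ?_⟩
      have hclose : ∀ p ∈ x :: l, ∀ q ∈ x :: l, |F i p - F i q| < δ := by
        intro p hp q hq
        have := hun p (hsub _ hl2 p hp) q (hsub _ hl2 q hq)
          ((hl2.2 p hp q hq).trans_lt (half_lt_self hη))
        exact ((dist_le_pi_dist _ _ i).trans_lt this)
      obtain ⟨p, hp, q, hq, hne⟩ := cup_ne_zero _ _ hl3 (sgnf χ F i)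
        (List.mem_map.2 ⟨i, by simp, rfl⟩)
      have h1 := sgnf_ne χ F i p q hne
      have h2 := hclose p hp q hq
      have h3 := hclose x (by simp) p hp
      have h4 : |F i x| ≤ |F i x - F i p| + |F i p| := by
        simpa using abs_add_le (F i x - F i p) (F i p)
      linarith
  have hne : (KK d : Set (ι → Eu d)).Nonempty := by
    obtain ⟨x, hx, -⟩ := key 1 one_pos
    exact ⟨x, hx⟩
  obtain ⟨x0, hx0, hmin⟩ := (KK_compact d).exists_isMinOn hne
    (f := fun x => ∑ i, |F i x|)
    (continuousOn_finsetSum _ fun i _ => ((hF i).mono hK0).abs)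
  refine ⟨x0, hK0 x0 hx0, ?_⟩
  have hle : ∑ i, |F i x0| ≤ 0 := by
    apply le_of_forall_pos_le_add
    intro e he
    obtain ⟨x, hx, hxi⟩ := key (e / (2 * (Fintype.card I + 1))) (by positivity)
    calc ∑ i, |F i x0| ≤ ∑ i, |F i x| := hmin hx
      _ ≤ ∑ _i : I, 2 * (e / (2 * (Fintype.card I + 1))) := Finset.sum_le_sum fun i _ => hxi i
      _ = Fintype.card I * (e / (Fintype.card I + 1)) := by
        simp; left; field_simp
      _ ≤ 0 + e := by
        rw [zero_add, mul_div_assoc', div_le_iff₀ (by positivity)]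
        nlinarith
  have h0 : ∑ i, |F i x0| = 0 := le_antisymm hle (Finset.sum_nonneg fun i _ => abs_nonneg _)
  intro i
  rw [Finset.sum_eq_zero_iff_of_nonneg (fun i _ => abs_nonneg _)] at h0
  exact abs_eq_zero.1 (h0 i (Finset.mem_univ i))

end BU

section Meas
open ProbabilityTheory Filter Topology
variable {d : ℕ}

structure GoodM (ν : Measure (Eu d)) : Prop where
  prob : IsProbabilityMeasure ν
  null : ∀ u : Eu d, u ≠ 0 → ∀ t : ℝ, ν {x | inner ℝ x u = t} = 0
  pos : ∀ U : Set (Eu d), IsOpen U → U.Nonempty → 0 < ν U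

noncomputable def GG (ν : Measure (Eu d)) (u : Eu d) (t : ℝ) : ℝ := ν.real {y | inner ℝ y u < t}

noncomputable def Ph (ν : Measure (Eu d)) (u x : Eu d) : ℝ := GG ν u (inner ℝ x u)

lemma meas_lt (u : Eu d) (t : ℝ) : MeasurableSet {y : Eu d | inner ℝ y u < t} :=
  (isOpen_lt (by fun_prop) continuous_const).measurableSet

lemma meas_le (u : Eu d) (t : ℝ) : MeasurableSet {y : Eu d | inner ℝ y u ≤ t} :=
  (isClosed_le (by fun_prop) continuous_const).measurableSet

variable {ν : Measure (Eu d)}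

lemma GG_cont (h : GoodM ν) (u : Eu d) (hu : u ≠ 0) (t : ℝ) :
    ContinuousAt (fun p : Eu d × ℝ => GG ν p.1 p.2) (u, t) := by
  have := h.prob
  have e : (fun p : Eu d × ℝ => GG ν p.1 p.2) = fun p : Eu d × ℝ =>
      ∫ y, {y : Eu d | inner ℝ y p.1 < p.2}.indicator (fun _ => (1 : ℝ)) y ∂ν := by
    funext p
    rw [integral_indicator (meas_lt _ _)]
    simp [GG]
  rw [e]
  apply continuousAt_of_dominated (bound := fun _ => (1 : ℝ))
  · refine Eventually.of_forall fun p => ?_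
    exact (measurable_const.indicator (meas_lt _ _)).aestronglyMeasurable
  · refine Eventually.of_forall fun p => Eventually.of_forall fun y => ?_
    by_cases hy : y ∈ {y : Eu d | inner ℝ y p.1 < p.2} <;> simp [Set.indicator, hy]
  · exact integrable_const _
  · have hn : ∀ᵐ y ∂ν, inner ℝ y u ≠ t := by
      rw [ae_iff]; simpa using h.null u hu t
    filter_upwards [hn] with y hy
    have hc : Continuous (fun p : Eu d × ℝ => (inner ℝ y p.1 : ℝ)) := by fun_prop
    rcases lt_or_gt_of_ne hy with h1 | h1
    · have : ∀ᶠ p : Eu d × ℝ in 𝓝 (u, t), (inner ℝ y p.1 : ℝ) < p.2 :=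
        hc.continuousAt.eventually_lt continuous_snd.continuousAt h1
      refine ContinuousAt.congr (f := fun _ => (1 : ℝ)) continuousAt_const ?_
      filter_upwards [this] with p hp
      simp [Set.indicator, hp]
    · have : ∀ᶠ p : Eu d × ℝ in 𝓝 (u, t), p.2 < (inner ℝ y p.1 : ℝ) :=
        continuous_snd.continuousAt.eventually_lt hc.continuousAt h1
      refine ContinuousAt.congr (f := fun _ => (0 : ℝ)) continuousAt_const ?_
      filter_upwards [this] with p hp
      simp [Set.indicator, hp.le]

lemma GG_strictMono (h : GoodM ν) (u : Eu d) (hu : u ≠ 0) : StrictMono (GG ν u) := by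
  have := h.prob
  intro s t hst
  have hpos : 0 < ν ({y : Eu d | s < inner ℝ y u} ∩ {y : Eu d | inner ℝ y u < t}) := by
    apply h.pos
    · exact (isOpen_lt continuous_const (by fun_prop)).inter (isOpen_lt (by fun_prop) continuous_const)
    · have hu2 : (inner ℝ u u : ℝ) ≠ 0 := by simpa using hu
      refine ⟨(((s + t) / 2) / inner ℝ u u) • u, ?_, ?_⟩
      · simp only [Set.mem_ofPred_eq, inner_smul_left, RCLike.conj_to_real]
        rw [div_mul_cancel₀ _ hu2]; linarith
      · simp only [Set.mem_ofPred_eq, inner_smul_left, RCLike.conj_to_real]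
        rw [div_mul_cancel₀ _ hu2]; linarith
  have hr : 0 < ν.real ({y : Eu d | s < inner ℝ y u} ∩ {y : Eu d | inner ℝ y u < t}) :=
    ENNReal.toReal_pos hpos.ne' (measure_ne_top _ _)
  have hdisj : Disjoint {y : Eu d | inner ℝ y u < s}
      ({y : Eu d | s < inner ℝ y u} ∩ {y : Eu d | inner ℝ y u < t}) := by
    rw [Set.disjoint_left]
    rintro y h1 ⟨h2, -⟩
    exact lt_asymm (show inner ℝ y u < s from h1) (show s < inner ℝ y u from h2)
  have hun := measureReal_union (μ := ν) hdisj
    ((isOpen_lt continuous_const (by fun_prop)).inter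
      (isOpen_lt (by fun_prop) continuous_const)).measurableSet
  have hle : ν.real ({y : Eu d | inner ℝ y u < s} ∪
      ({y : Eu d | s < inner ℝ y u} ∩ {y : Eu d | inner ℝ y u < t})) ≤ GG ν u t := by
    refine measureReal_mono ?_ (measure_ne_top _ _)
    rintro y (h1 | h1)
    · exact lt_trans (show inner ℝ y u < s from h1) hst
    · exact h1.2
  have : GG ν u s = ν.real {y : Eu d | inner ℝ y u < s} := rfl
  linarith

lemma GG_le (h : GoodM ν) (u : Eu d) (hu : u ≠ 0) (t : ℝ) :
    ν.real {y | inner ℝ y u ≤ t} = GG ν u t := by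
  have := h.prob
  apply measureReal_congr
  have hn : ∀ᵐ y ∂ν, inner ℝ y u ≠ t := by
    rw [ae_iff]; simpa using h.null u hu t
  filter_upwards [hn] with y hy
  exact propext ⟨fun h1 => lt_of_le_of_ne h1 hy, fun h1 => le_of_lt h1⟩

lemma GG_exists (h : GoodM ν) (u : Eu d) (hu : u ≠ 0) {c : ℝ} (h0 : 0 < c) (h1 : c < 1) :
    ∃ t, GG ν u t = c := by
  have := h.prob
  have hcont : Continuous (GG ν u) := by
    rw [continuous_iff_continuousAt]
    intro t
    exact (GG_cont h u hu t).comp (f := fun t : ℝ => (u, t)) (by fun_prop)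
  have hm : Measurable (fun y : Eu d => (inner ℝ y u : ℝ)) := by fun_prop
  have hcdf : ∀ t, cdf (ν.map (fun y : Eu d => (inner ℝ y u : ℝ))) t = GG ν u t := by
    intro t
    have := Measure.isProbabilityMeasure_map (μ := ν) hm.aemeasurable
    rw [cdf_eq_real, map_measureReal_apply hm measurableSet_Iic, ← GG_le h u hu]
    rfl
  have hb := (tendsto_cdf_atBot (ν.map (fun y : Eu d => (inner ℝ y u : ℝ)))).eventually
    (gt_mem_nhds h0)
  have ht := (tendsto_cdf_atTop (ν.map (fun y : Eu d => (inner ℝ y u : ℝ)))).eventually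
    (lt_mem_nhds h1)
  obtain ⟨a, ha⟩ := hb.exists
  obtain ⟨b, hb⟩ := ht.exists
  rw [hcdf] at ha hb
  exact mem_range_of_exists_le_of_exists_ge hcont ⟨a, ha.le⟩ ⟨b, hb.le⟩

lemma GG_pos (h : GoodM ν) (u : Eu d) (hu : u ≠ 0) (t : ℝ) : 0 < GG ν u t :=
  lt_of_le_of_lt measureReal_nonneg (GG_strictMono h u hu (sub_one_lt t))

lemma GG_lt_one (h : GoodM ν) (u : Eu d) (hu : u ≠ 0) (t : ℝ) : GG ν u t < 1 := by
  have := h.prob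
  exact lt_of_lt_of_le (GG_strictMono h u hu (lt_add_one t)) measureReal_le_one

lemma Ph_neg (h : GoodM ν) (u : Eu d) (hu : u ≠ 0) (x : Eu d) : Ph ν (-u) x = 1 - Ph ν u x := by
  have := h.prob
  unfold Ph
  rw [← GG_le h u hu, ← probReal_compl_eq_one_sub (meas_le _ _)]
  unfold GG
  congr 1
  ext y
  simp

lemma Ph_smul (u : Eu d) (c : ℝ) (hc : 0 < c) : Ph ν (c • u) = Ph ν u := by
  funext x
  unfold Ph GG
  congr 1
  ext y
  simp only [Set.mem_ofPred_eq, inner_smul_right]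
  exact mul_lt_mul_iff_right₀ hc

lemma Ph_meas (h : GoodM ν) (u : Eu d) : Measurable (Ph ν u) := by
  have := h.prob
  have hm : Measurable (fun y : Eu d => (inner ℝ y u : ℝ)) := by fun_prop
  have : Monotone (GG ν u) := fun s t hst => measureReal_mono fun y hy => lt_of_lt_of_le hy hst
  exact this.measurable.comp hm

lemma Ph_null (h : GoodM ν) (u : Eu d) (hu : u ≠ 0) (c : ℝ) : ∀ᵐ y ∂ν, Ph ν u y ≠ c := by
  rw [ae_iff]
  simp only [not_not]
  by_cases hex : ∃ y, Ph ν u y = c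
  · obtain ⟨y, rfl⟩ := hex
    refine measure_mono_null ?_ (h.null u hu (inner ℝ y u))
    intro z hz
    exact (GG_strictMono h u hu).injective hz
  · convert measure_empty (μ := ν)
    ext y
    simpa using fun e => hex ⟨y, e⟩

lemma Ph_cont (h : GoodM ν) (u : Eu d) (hu : u ≠ 0) (y : Eu d) :
    ContinuousAt (fun v => Ph ν v y) u := by
  exact (GG_cont h u hu (inner ℝ y u)).comp (f := fun v : Eu d => (v, (inner ℝ y v : ℝ)))
    (by fun_prop)

lemma Ph_law (h : GoodM ν) (u : Eu d) (hu : u ≠ 0) {c : ℝ} (h0 : 0 ≤ c) (h1 : c ≤ 1) :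
    ν.real {y | Ph ν u y < c} = c := by
  have := h.prob
  rcases h0.eq_or_lt with rfl | h0
  · have : {y | Ph ν u y < 0} = ∅ := by
      ext y
      simp only [Set.mem_ofPred_eq, Set.mem_empty_iff_false, iff_false, not_lt]
      exact (GG_pos h u hu _).le
    rw [this]; simp
  rcases h1.eq_or_lt with rfl | h1
  · have : {y | Ph ν u y < 1} = Set.univ := by
      ext y
      simp only [Set.mem_ofPred_eq, Set.mem_univ, iff_true]
      exact GG_lt_one h u hu _
    rw [this]; simp
  obtain ⟨t, ht⟩ := GG_exists h u hu h0 h1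
  have : {y | Ph ν u y < c} = {y | inner ℝ y u < t} := by
    ext y
    rw [← ht]
    exact (GG_strictMono h u hu).lt_iff_lt
  rw [this]; exact ht

lemma Ph_law_le (h : GoodM ν) (u : Eu d) (hu : u ≠ 0) {c : ℝ} (h0 : 0 ≤ c) (h1 : c ≤ 1) :
    ν.real {y | Ph ν u y ≤ c} = c := by
  refine Eq.trans ?_ (Ph_law h u hu h0 h1)
  apply measureReal_congr
  filter_upwards [Ph_null h u hu c] with y hy
  exact propext ⟨fun h1 => lt_of_le_of_ne h1 hy, fun h1 => le_of_lt h1⟩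

structure Nice (a : ℝ → ℝ) : Prop where
  meas : Measurable a
  bdd : ∀ y, |a y| ≤ 2
  cont : ∃ S : Set ℝ, S.Finite ∧ ∀ y, y ∉ S → ContinuousAt a y

noncomputable def JJ (ν : Measure (Eu d)) (a b c : ℝ → ℝ) (x : Fin 3 → Eu d) : ℝ :=
  ∫ y, a (Ph ν (x 0) y) * b (Ph ν (x 1) y) * c (Ph ν (x 2) y) ∂ν

lemma JJ_int (h : GoodM ν) {a b c : ℝ → ℝ} (ha : Nice a) (hb : Nice b) (hc : Nice c)
    (x : Fin 3 → Eu d) :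
    Integrable (fun y => a (Ph ν (x 0) y) * b (Ph ν (x 1) y) * c (Ph ν (x 2) y)) ν := by
  have := h.prob
  have hm : Measurable (fun y => a (Ph ν (x 0) y) * b (Ph ν (x 1) y) * c (Ph ν (x 2) y)) :=
    ((ha.meas.comp (Ph_meas h _)).mul (hb.meas.comp (Ph_meas h _))).mul
      (hc.meas.comp (Ph_meas h _))
  refine Integrable.of_bound hm.aestronglyMeasurable (2 * 2 * 2) (Eventually.of_forall fun y => ?_)
  rw [norm_mul, norm_mul]
  gcongr
  · exact ha.bdd _
  · exact hb.bdd _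
  · exact hc.bdd _

lemma Nice.ae_cont {a : ℝ → ℝ} (ha : Nice a) (h : GoodM ν) (u : Eu d) (hu : u ≠ 0) :
    ∀ᵐ y ∂ν, ContinuousAt a (Ph ν u y) := by
  obtain ⟨S, hS, hc⟩ := ha.cont
  have : ∀ᵐ y ∂ν, ∀ s ∈ S, Ph ν u y ≠ s :=
    (ae_ball_iff hS.countable).2 fun s _ => Ph_null h u hu s
  filter_upwards [this] with y hy
  exact hc _ fun hm => hy _ hm rfl

lemma JJ_cont (h : GoodM ν) {a b c : ℝ → ℝ} (ha : Nice a) (hb : Nice b) (hc : Nice c) :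
    ContinuousOn (JJ ν a b c) {x | ∀ j, x j ≠ 0} := by
  have := h.prob
  intro x hx
  apply ContinuousAt.continuousWithinAt
  unfold JJ
  apply continuousAt_of_dominated (bound := fun _ => (2 * 2 * 2 : ℝ))
  · exact Eventually.of_forall fun p => (JJ_int h ha hb hc p).aestronglyMeasurable
  · refine Eventually.of_forall fun p => Eventually.of_forall fun y => ?_
    rw [norm_mul, norm_mul]
    gcongr
    · exact ha.bdd _
    · exact hb.bdd _
    · exact hc.bdd _
  · exact integrable_const _
  · have key : ∀ (j : Fin 3) (y : Eu d), ContinuousAt (fun x : Fin 3 → Eu d => Ph ν (x j) y) x :=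
      fun j y => (Ph_cont h (x j) (hx j) y).comp (f := fun x : Fin 3 → Eu d => x j)
        (continuous_apply j).continuousAt
    filter_upwards [ha.ae_cont h (x 0) (hx 0), hb.ae_cont h (x 1) (hx 1),
      hc.ae_cont h (x 2) (hx 2)] with y h0 h1 h2
    exact ((h0.comp (f := fun x : Fin 3 → Eu d => Ph ν (x 0) y) (key 0 y)).mul
      (h1.comp (f := fun x : Fin 3 → Eu d => Ph ν (x 1) y) (key 1 y))).mul
      (h2.comp (f := fun x : Fin 3 → Eu d => Ph ν (x 2) y) (key 2 y))

def Par (e : ZMod 2) (a : ℝ → ℝ) : Prop := ∀ y, a (1 - y) = if e = 0 then a y else - a y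

lemma JJ_flip (h : GoodM ν) {a b c : ℝ → ℝ} (e : Fin 3 → ZMod 2) (ha : Par (e 0) a)
    (hb : Par (e 1) b) (hc : Par (e 2) c) (x : Fin 3 → Eu d) (hx : ∀ j, x j ≠ 0) (j : Fin 3) :
    JJ ν a b c (flip d j x) = if e j = 0 then JJ ν a b c x else - JJ ν a b c x := by
  unfold JJ
  have hneg : ∀ (p : Prop) [Decidable p] (f : Eu d → ℝ), (if p then ∫ y, f y ∂ν else - ∫ y, f y ∂ν) =
      ∫ y, (if p then f y else - f y) ∂ν := by
    intro p _ f
    split_ifs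
    · rfl
    · rw [integral_neg]
  rw [hneg]
  congr 1
  funext y
  fin_cases j
  · simp only [flip_apply, Fin.zero_eta, if_true, Fin.reduceEq, if_false, one_ne_zero]
    rw [Ph_neg h _ (hx 0), ha]
    split_ifs <;> ring
  · simp only [flip_apply, Fin.mk_one, if_true, Fin.reduceEq, if_false, zero_ne_one]
    rw [Ph_neg h _ (hx 1), hb]
    split_ifs <;> ring
  · simp only [flip_apply, Fin.reduceFinMk, if_true, Fin.reduceEq, if_false]
    rw [Ph_neg h _ (hx 2), hc]
    split_ifs <;> ring

noncomputable def th (N : ℕ) (i : ℕ) (y : ℝ) : ℝ :=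
  if (i : ℝ) < N * y ∧ (N : ℝ) * y < i + 1 then 1 else 0

noncomputable def hh (y : ℝ) : ℝ := if y < 1 / 2 then 1 else if 1 / 2 < y then -1 else 0

lemma th_meas (N i : ℕ) : Measurable (th N i) := by
  unfold th
  refine Measurable.ite ?_ measurable_const measurable_const
  exact (measurableSet_lt measurable_const (measurable_const.mul measurable_id)).inter
    (measurableSet_lt (measurable_const.mul measurable_id) measurable_const)

lemma th_nonneg (N i : ℕ) (y : ℝ) : 0 ≤ th N i y := by unfold th; split_ifs <;> norm_num

lemma th_le (N i : ℕ) (y : ℝ) : th N i y ≤ 1 := by unfold th; split_ifs <;> norm_num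

lemma th_cont (N i : ℕ) (hN : 0 < N) : ∃ S : Set ℝ, S.Finite ∧ ∀ y, y ∉ S →
    ContinuousAt (th N i) y := by
  have hN' : (0 : ℝ) < N := by exact_mod_cast hN
  refine ⟨{(i : ℝ) / N, (i + 1 : ℝ) / N}, by simp, fun y hy => ?_⟩
  simp only [Set.mem_insert_iff, Set.mem_singleton_iff, not_or, eq_div_iff hN'.ne'] at hy
  have hc : ContinuousAt (fun y : ℝ => (N : ℝ) * y) y := by fun_prop
  by_cases h1 : (i : ℝ) < N * y
  · rcases lt_or_gt_of_ne (fun e => hy.2 ((mul_comm _ _).trans e) : (N : ℝ) * y ≠ i + 1) with h2 | h2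
    · refine ContinuousAt.congr (f := fun _ => (1 : ℝ)) continuousAt_const ?_
      filter_upwards [hc.eventually_const_lt h1, hc.eventually_lt_const h2] with z a b
      simp [th, a, b]
    · refine ContinuousAt.congr (f := fun _ => (0 : ℝ)) continuousAt_const ?_
      filter_upwards [hc.eventually_const_lt h2] with z a
      simp [th, a.le]
  · have h1' : (N : ℝ) * y < i := lt_of_le_of_ne (not_lt.1 h1) (fun e => hy.1 ((mul_comm _ _).trans e))
    refine ContinuousAt.congr (f := fun _ => (0 : ℝ)) continuousAt_const ?_
    filter_upwards [hc.eventually_lt_const h1'] with z a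
    simp [th, not_lt_of_gt a]

lemma th_nice (N i : ℕ) (hN : 0 < N) : Nice (th N i) :=
  ⟨th_meas N i, fun y => by rw [abs_of_nonneg (th_nonneg N i y)]; linarith [th_le N i y],
    th_cont N i hN⟩

lemma th_nice_comb (N i j : ℕ) (hN : 0 < N) (s : ℝ) (hs : |s| ≤ 1) :
    Nice (fun y => th N i y + s * th N j y) := by
  refine ⟨(th_meas N i).add ((th_meas N j).const_mul s), fun y => ?_, ?_⟩
  · have h1 := th_nonneg N i y
    have h2 := th_le N i y
    have h3 := th_nonneg N j y
    have h4 := th_le N j y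
    calc |th N i y + s * th N j y| ≤ |th N i y| + |s * th N j y| := abs_add_le _ _
      _ = th N i y + |s| * th N j y := by rw [abs_mul, abs_of_nonneg h1, abs_of_nonneg h3]
      _ ≤ 2 := by nlinarith [abs_nonneg s]
  · obtain ⟨S, hS, h1⟩ := th_cont N i hN
    obtain ⟨S', hS', h1'⟩ := th_cont N j hN
    refine ⟨S ∪ S', hS.union hS', fun y hy => ?_⟩
    rw [Set.mem_union, not_or] at hy
    exact (h1 y hy.1).add ((h1' y hy.2).const_mul s)

lemma hh_nice : Nice hh := by
  refine ⟨?_, ?_, {1 / 2}, by simp, ?_⟩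
  · unfold hh
    exact Measurable.ite measurableSet_Iio measurable_const
      (Measurable.ite measurableSet_Ioi measurable_const measurable_const)
  · intro y; unfold hh; split_ifs <;> norm_num
  · intro y hy
    rcases lt_or_gt_of_ne (hy : y ≠ 1 / 2) with h1 | h1
    · refine ContinuousAt.congr (f := fun _ => (1 : ℝ)) continuousAt_const ?_
      filter_upwards [gt_mem_nhds h1] with z a
      rw [hh, if_pos a]
    · refine ContinuousAt.congr (f := fun _ => (-1 : ℝ)) continuousAt_const ?_
      filter_upwards [lt_mem_nhds h1] with z a
      rw [hh, if_neg (not_lt_of_gt a), if_pos a]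

lemma one_nice : Nice (fun _ => 1) := by
  refine ⟨measurable_const, by intro y; norm_num, ∅, by simp, fun y _ => continuousAt_const⟩

lemma th_refl {N i j : ℕ} (hN : i + j + 1 = N) (y : ℝ) : th N i (1 - y) = th N j y := by
  have : (N : ℝ) = i + j + 1 := by rw [← hN]; push_cast; ring
  unfold th
  congr 1
  rw [this]
  apply propext
  constructor <;> rintro ⟨h1, h2⟩ <;> constructor <;> linarith

lemma hh_par : Par 1 hh := by
  intro y
  rw [if_neg one_ne_zero]
  unfold hh
  split_ifs <;> first | (exfalso; linarith) | norm_num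

lemma one_par : Par 0 (fun _ => 1) := by intro y; simp

end Meas

section Zeros
open Filter Topology MvPolynomial
variable {d : ℕ} {ν : Measure (Eu d)}

lemma exists_coeff (P : MvPolynomial (Fin 3) (ZMod 2)) (d : ℕ)
    (hQ : P ∉ Ideal.span {(X 0 : MvPolynomial (Fin 3) (ZMod 2)) ^ d, X 1 ^ d, X 2 ^ d}) :
    ∃ n : Fin 3 →₀ ℕ, (∀ j, n j < d) ∧ coeff n P ≠ 0 := by
  by_contra hcon
  apply hQ
  have himg : ({(X 0 : MvPolynomial (Fin 3) (ZMod 2)) ^ d, X 1 ^ d, X 2 ^ d} :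
      Set (MvPolynomial (Fin 3) (ZMod 2))) =
      (fun s => monomial s (1 : ZMod 2)) '' {Finsupp.single 0 d, Finsupp.single 1 d, Finsupp.single 2 d} := by
    simp only [Set.image_insert_eq, Set.image_singleton, X_pow_eq_monomial]
  rw [himg, mem_ideal_span_monomial_image]
  intro n hn
  rw [mem_support_iff] at hn
  have : ∃ j, d ≤ n j := by
    by_contra hj
    push Not at hj
    exact hcon ⟨n, hj, hn⟩
  obtain ⟨j, hj⟩ := this
  refine ⟨Finsupp.single j d, ?_, ?_⟩
  · fin_cases j <;> simp
  · simpa using hj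

def chi6 : Fin 6 → Fin 3 → ZMod 2 :=
  ![![0,1,0],![0,0,1],![1,1,0],![1,0,1],![0,1,1],![1,1,1]]

def chiAll (k : ℕ) : (Fin k × Fin 6) ⊕ Unit → Fin 3 → ZMod 2
  | Sum.inl p => chi6 p.2
  | Sum.inr _ => ![0,1,1]

lemma poly_eq (k : ℕ) : (∏ i, ∑ j, C (chiAll k i j) * X j : MvPolynomial (Fin 3) (ZMod 2)) =
    (X 1 + X 2) *
        (X 1 * X 2 * (X 0 + X 1) * (X 0 + X 2) * (X 1 + X 2) * (X 0 + X 1 + X 2)) ^ k := by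
  rw [Fintype.prod_sum_type, Fintype.prod_prod_type]
  simp only [chiAll, Finset.prod_const, Finset.card_univ, Fintype.card_fin, Fin.sum_univ_three,
    Fin.prod_univ_six, chi6]
  simp [mul_comm]

noncomputable def bF (e : ZMod 2) : ℝ → ℝ := if e = 0 then (fun _ => 1) else hh

lemma bF_nice (e : ZMod 2) : Nice (bF e) := by
  unfold bF
  split_ifs
  · exact one_nice
  · exact hh_nice

lemma bF_par (e : ZMod 2) : Par e (bF e) := by
  rcases zmod2_cases e with rfl | rfl
  · exact one_par
  · simpa [bF] using hh_par

noncomputable def cF (k : ℕ) (e : ZMod 2) (i : ℕ) : ℝ → ℝ :=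
  fun y => th (2 * k + 1) i y + (if e = 0 then 1 else -1) * th (2 * k + 1) (2 * k - i) y

lemma cF_nice (k : ℕ) (e : ZMod 2) (i : ℕ) : Nice (cF k e i) := by
  apply th_nice_comb _ _ _ (by omega)
  split_ifs <;> simp

lemma cF_par (k : ℕ) (e : ZMod 2) (i : ℕ) (hi : i ≤ 2 * k) : Par e (cF k e i) := by
  intro y
  unfold cF
  rw [th_refl (i := i) (j := 2 * k - i) (by omega), th_refl (i := 2 * k - i) (j := i) (by omega)]
  split_ifs <;> ring

lemma thk_par (k : ℕ) : Par 0 (th (2 * k + 1) k) := by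
  intro y
  rw [th_refl (i := k) (j := k) (by omega)]
  simp

lemma JJ_lin (h : GoodM ν) {a a' b c : ℝ → ℝ} (ha : Nice a) (ha' : Nice a') (hb : Nice b)
    (hc : Nice c) (s : ℝ) (x : Fin 3 → Eu d) :
    JJ ν (fun y => a y + s * a' y) b c x = JJ ν a b c x + s * JJ ν a' b c x := by
  unfold JJ
  rw [← integral_const_mul, ← integral_add (JJ_int h ha hb hc x) ((JJ_int h ha' hb hc x).const_mul s)]
  congr 1
  funext y
  ring

lemma th_sum {N : ℕ} (hN : 0 < N) (y : ℝ) (h0 : 0 < y) (h1 : y < 1)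
    (hy : ∀ i ∈ Finset.range N, y ≠ (i : ℝ) / N) : ∑ i ∈ Finset.range N, th N i y = 1 := by
  have hN' : (0 : ℝ) < N := by exact_mod_cast hN
  have hpos : 0 ≤ (N : ℝ) * y := by positivity
  have hfl : ⌊(N : ℝ) * y⌋₊ < N := by
    rw [Nat.floor_lt hpos]
    nlinarith
  rw [Finset.sum_eq_single_of_mem ⌊(N : ℝ) * y⌋₊ (Finset.mem_range.2 hfl)]
  · unfold th
    rw [if_pos]
    refine ⟨lt_of_le_of_ne (Nat.floor_le hpos) ?_, Nat.lt_floor_add_one _⟩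
    intro e
    apply hy _ (Finset.mem_range.2 hfl)
    rw [e]; field_simp
  · intro j _ hj
    unfold th
    rw [if_neg]
    rintro ⟨h2, h3⟩
    apply hj
    symm
    rw [Nat.floor_eq_iff hpos]
    exact ⟨h2.le, h3⟩

lemma JJ_sum (h : GoodM ν) {N : ℕ} (hN : 0 < N) {b c : ℝ → ℝ} (hb : Nice b)
    (hc : Nice c) (x : Fin 3 → Eu d) (hx : ∀ j, x j ≠ 0) :
    ∑ i ∈ Finset.range N, JJ ν (th N i) b c x = JJ ν (fun _ => 1) b c x := by
  unfold JJ
  rw [← integral_finsetSum _ fun i _ => JJ_int h (th_nice N i hN) hb hc x]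
  apply integral_congr_ae
  have hn : ∀ᵐ y ∂ν, ∀ i ∈ Finset.range N, Ph ν (x 0) y ≠ (i : ℝ) / N :=
    (ae_ball_iff (Finset.range N).countable_toSet).2 fun i _ => Ph_null h _ (hx 0) _
  filter_upwards [hn] with y hy
  rw [← th_sum hN (Ph ν (x 0) y) (GG_pos h _ (hx 0) _) (GG_lt_one h _ (hx 0) _) hy]
  simp only [Finset.sum_mul]

lemma Ph_lt_meas (h : GoodM ν) (u : Eu d) (c : ℝ) : MeasurableSet {y | Ph ν u y < c} :=
  measurableSet_lt (Ph_meas h u) measurable_const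

lemma int_ind (h : GoodM ν) (u : Eu d) (c : ℝ) :
    ∫ y, {y | Ph ν u y < c}.indicator (fun _ => (1 : ℝ)) y ∂ν = ν.real {y | Ph ν u y < c} :=
  integral_indicator_one (Ph_lt_meas h u c)

lemma int_hh (h : GoodM ν) (u : Eu d) (hu : u ≠ 0) : ∫ y, hh (Ph ν u y) ∂ν = 0 := by
  have := h.prob
  have e : ∫ y, hh (Ph ν u y) ∂ν =
      ∫ y, (2 * {y | Ph ν u y < 1 / 2}.indicator (fun _ => (1 : ℝ)) y - 1) ∂ν := by
    apply integral_congr_ae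
    filter_upwards [Ph_null h u hu (1 / 2)] with y hy
    unfold hh
    rcases lt_or_gt_of_ne hy with h1 | h1
    · rw [if_pos h1, Set.indicator_of_mem (by exact h1)]; norm_num
    · rw [if_neg (not_lt_of_gt h1), if_pos h1, Set.indicator_of_notMem (by exact not_lt_of_gt h1)]
      norm_num
  rw [e, integral_sub, integral_const_mul, int_ind h,
    Ph_law h u hu (by norm_num) (by norm_num)]
  · simp
  · exact ((integrable_const (1 : ℝ)).indicator (Ph_lt_meas h _ _)).const_mul 2
  · exact integrable_const _

lemma int_th (h : GoodM ν) (u : Eu d) (hu : u ≠ 0) {N i : ℕ} (hi : i < N) :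
    ∫ y, th N i (Ph ν u y) ∂ν = 1 / N := by
  have := h.prob
  have hN' : (0 : ℝ) < N := by exact_mod_cast (by omega : 0 < N)
  have hi' : (i : ℝ) + 1 ≤ N := by exact_mod_cast hi
  have e : ∫ y, th N i (Ph ν u y) ∂ν =
      ∫ y, ({y | Ph ν u y < ((i : ℝ) + 1) / N}.indicator (fun _ => (1 : ℝ)) y
        - {y | Ph ν u y < (i : ℝ) / N}.indicator (fun _ => (1 : ℝ)) y) ∂ν := by
    apply integral_congr_ae
    filter_upwards [Ph_null h u hu ((i : ℝ) / N)] with y hy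
    unfold th
    simp only [Set.indicator, Set.mem_ofPred_eq, lt_div_iff₀ hN']
    rw [ne_eq, eq_div_iff hN'.ne'] at hy
    rw [mul_comm (N : ℝ)]
    rcases lt_or_gt_of_ne hy with h1 | h1
    · rw [if_neg (fun hc => lt_asymm h1 hc.1), if_pos h1, if_pos (by linarith)]; norm_num
    · rw [if_neg (not_lt_of_gt h1)]
      by_cases h2 : Ph ν u y * N < i + 1
      · rw [if_pos ⟨h1, h2⟩, if_pos h2]; norm_num
      · rw [if_neg (fun hc => h2 hc.2), if_neg h2]; norm_num
  rw [e, integral_sub, int_ind h,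
    int_ind h,
    Ph_law h u hu (by positivity) (by rw [div_le_one hN']; linarith),
    Ph_law h u hu (by positivity) (by rw [div_le_one hN']; linarith)]
  · ring
  · exact ((integrable_const (1 : ℝ)).indicator (Ph_lt_meas h _ _))
  · exact ((integrable_const (1 : ℝ)).indicator (Ph_lt_meas h _ _))

noncomputable def FF (ν : Measure (Eu d)) (k : ℕ) : (Fin k × Fin 6) ⊕ Unit → (Fin 3 → Eu d) → ℝ
  | Sum.inl p => JJ ν (cF k (chi6 p.2 0) p.1) (bF (chi6 p.2 1)) (bF (chi6 p.2 2))
  | Sum.inr _ => JJ ν (th (2 * k + 1) k) (bF 1) (bF 1)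

lemma exists_zeros (h : GoodM ν) (k : ℕ) (hd : 0 < d) (n : Fin 3 →₀ ℕ) (hn : ∀ j, n j < d)
    (hc : coeff n ((X 1 + X 2) *
        (X 1 * X 2 * (X 0 + X 1) * (X 0 + X 2) * (X 1 + X 2) * (X 0 + X 1 + X 2)) ^ k :
          MvPolynomial (Fin 3) (ZMod 2)) ≠ 0) :
    ∃ x : Fin 3 → Eu d, (∀ j, x j ≠ 0) ∧ ∀ i, FF ν k i x = 0 := by
  refine borsuk_ulam d (chiAll k) (FF ν k) ?_ ?_ hd n hn (by rw [poly_eq]; exact hc)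
  · rintro (⟨i, m⟩ | _)
    · exact JJ_cont h (cF_nice _ _ _) (bF_nice _) (bF_nice _)
    · exact JJ_cont h (th_nice _ _ (by omega)) (bF_nice _) (bF_nice _)
  · rintro (⟨i, m⟩ | _) j x hx
    · exact JJ_flip h (chi6 m) (cF_par _ _ _ (by omega)) (bF_par _) (bF_par _) x hx j
    · exact JJ_flip h ![0, 1, 1] (thk_par k) (bF_par 1) (bF_par 1) x hx j

lemma cF_zero (h : GoodM ν) {k i : ℕ} {b c : ℝ → ℝ} (hb : Nice b) (hc : Nice c)
    (x : Fin 3 → Eu d) (h0 : JJ ν (cF k 0 i) b c x = 0) (h1 : JJ ν (cF k 1 i) b c x = 0) :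
    JJ ν (th (2 * k + 1) i) b c x = 0 ∧ JJ ν (th (2 * k + 1) (2 * k - i)) b c x = 0 := by
  unfold cF at h0 h1
  rw [JJ_lin h (th_nice _ _ (by omega)) (th_nice _ _ (by omega)) hb hc] at h0 h1
  simp only [if_true, one_ne_zero, if_false] at h0 h1
  constructor <;> linarith

lemma zeros_side {k : ℕ} {J : ℕ → ℝ} (h : ∀ i < k, J i = 0 ∧ J (2 * k - i) = 0) :
    ∀ i ≤ 2 * k, i ≠ k → J i = 0 := by
  intro i hi hne
  rcases lt_or_gt_of_ne hne with h1 | h1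
  · exact (h i h1).1
  · have := (h (2 * k - i) (by omega)).2
    rwa [show 2 * k - (2 * k - i) = i by omega] at this

lemma zeros_all (h : GoodM ν) {k : ℕ} {b c : ℝ → ℝ} (hb : Nice b) (hc : Nice c)
    (x : Fin 3 → Eu d) (hx : ∀ j, x j ≠ 0)
    (hz : ∀ i ≤ 2 * k, i ≠ k → JJ ν (th (2 * k + 1) i) b c x = 0)
    (h1 : JJ ν (fun _ => 1) b c x = 0) (i : ℕ) (hi : i ≤ 2 * k) :
    JJ ν (th (2 * k + 1) i) b c x = 0 := by
  by_cases hik : i = k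
  · subst hik
    rw [← JJ_sum h (N := 2 * i + 1) (by omega) hb hc x hx] at h1
    rwa [Finset.sum_eq_single_of_mem i (Finset.mem_range.2 (by omega))] at h1
    intro j hj hne
    rw [Finset.mem_range] at hj
    exact hz j (by omega) hne
  · exact hz i hi hik

lemma exists_good (h : GoodM ν) (k : ℕ) (hd : 0 < d) (n : Fin 3 →₀ ℕ) (hn : ∀ j, n j < d)
    (hc : coeff n ((X 1 + X 2) *
        (X 1 * X 2 * (X 0 + X 1) * (X 0 + X 2) * (X 1 + X 2) * (X 0 + X 1 + X 2)) ^ k :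
          MvPolynomial (Fin 3) (ZMod 2)) ≠ 0) :
    ∃ x : Fin 3 → Eu d, (∀ j, x j ≠ 0) ∧ ∀ i ≤ 2 * k,
      JJ ν (th (2 * k + 1) i) (fun _ => 1) (fun _ => 1) x = 1 / ((2 * k + 1 : ℕ) : ℝ) ∧
      JJ ν (th (2 * k + 1) i) hh (fun _ => 1) x = 0 ∧
      JJ ν (th (2 * k + 1) i) (fun _ => 1) hh x = 0 ∧
      JJ ν (th (2 * k + 1) i) hh hh x = 0 := by
  obtain ⟨x, hx, hz⟩ := exists_zeros h k hd n hn hc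
  refine ⟨x, hx, fun i hi => ⟨?_, ?_, ?_, ?_⟩⟩
  · rw [← int_th h (x 0) (hx 0) (show i < 2 * k + 1 by omega)]
    simp [JJ]
  · refine zeros_all h hh_nice one_nice x hx (zeros_side fun i hi => ?_) ?_ i hi
    · apply cF_zero h hh_nice one_nice
      · simpa [FF, chi6, bF] using hz (Sum.inl (⟨i, hi⟩, 0))
      · simpa [FF, chi6, bF] using hz (Sum.inl (⟨i, hi⟩, 2))
    · simpa [JJ] using int_hh h (x 1) (hx 1)
  · refine zeros_all h one_nice hh_nice x hx (zeros_side fun i hi => ?_) ?_ i hi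
    · apply cF_zero h one_nice hh_nice
      · simpa [FF, chi6, bF] using hz (Sum.inl (⟨i, hi⟩, 1))
      · simpa [FF, chi6, bF] using hz (Sum.inl (⟨i, hi⟩, 3))
    · simpa [JJ] using int_hh h (x 2) (hx 2)
  · by_cases hik : i = k
    · subst hik
      simpa [FF, bF] using hz (Sum.inr ())
    · refine zeros_side (J := fun i => JJ ν (th (2 * k + 1) i) hh hh x) (fun i hi => ?_) i hi hik
      apply cF_zero h hh_nice hh_nice
      · simpa [FF, chi6, bF] using hz (Sum.inl (⟨i, hi⟩, 4))
      · simpa [FF, chi6, bF] using hz (Sum.inl (⟨i, hi⟩, 5))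

/-- indicator of a half: `1` if on the side given by `b`. -/
noncomputable def hb (b : Bool) (y : ℝ) : ℝ := (1 + (if b then 1 else -1) * hh y) / 2

def hset (ν : Measure (Eu d)) (u : Eu d) (b : Bool) : Set (Eu d) :=
  if b then {y | Ph ν u y < 1 / 2} else {y | 1 / 2 < Ph ν u y}

lemma hset_meas (h : GoodM ν) (u : Eu d) (b : Bool) : MeasurableSet (hset ν u b) := by
  cases b
  · exact measurableSet_lt measurable_const (Ph_meas h u)
  · exact measurableSet_lt (Ph_meas h u) measurable_const

lemma hset_ind (u : Eu d) (b : Bool) (y : Eu d) (hy : Ph ν u y ≠ 1 / 2) :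
    (hset ν u b).indicator (fun _ => (1 : ℝ)) y = hb b (Ph ν u y) := by
  unfold hset hb hh
  rcases lt_or_gt_of_ne hy with h1 | h1 <;> cases b <;>
    simp only [Set.indicator, if_true, Bool.false_eq_true, if_false, Set.mem_ofPred_eq, h1,
      not_lt_of_gt h1] <;> norm_num

def sset (ν : Measure (Eu d)) (u : Eu d) (N i : ℕ) : Set (Eu d) :=
  {y | (i : ℝ) < N * Ph ν u y ∧ (N : ℝ) * Ph ν u y < i + 1}

lemma sset_meas (h : GoodM ν) (u : Eu d) (N i : ℕ) : MeasurableSet (sset ν u N i) :=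
  (measurableSet_lt measurable_const (measurable_const.mul (Ph_meas h u))).inter
    (measurableSet_lt (measurable_const.mul (Ph_meas h u)) measurable_const)

lemma sset_ind (u : Eu d) (N i : ℕ) (y : Eu d) :
    (sset ν u N i).indicator (fun _ => (1 : ℝ)) y = th N i (Ph ν u y) := by
  unfold sset th
  simp only [Set.indicator, Set.mem_ofPred_eq]

lemma box_meas (h : GoodM ν) {N i : ℕ} (hN : 0 < N) (x : Fin 3 → Eu d) (hx : ∀ j, x j ≠ 0)
    (h1 : JJ ν (th N i) (fun _ => 1) (fun _ => 1) x = 1 / (N : ℝ))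
    (h2 : JJ ν (th N i) hh (fun _ => 1) x = 0)
    (h3 : JJ ν (th N i) (fun _ => 1) hh x = 0)
    (h4 : JJ ν (th N i) hh hh x = 0) (b₁ b₂ : Bool) :
    ν.real (sset ν (x 0) N i ∩ hset ν (x 1) b₁ ∩ hset ν (x 2) b₂) = 1 / (4 * N) := by
  have := h.prob
  rw [← integral_indicator_one (((sset_meas h _ _ _).inter (hset_meas h _ _)).inter (hset_meas h _ _))]
  set s₁ : ℝ := if b₁ then 1 else -1 with hs₁
  set s₂ : ℝ := if b₂ then 1 else -1 with hs₂
  have hti := th_nice N i hN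
  have e : ∫ y, (sset ν (x 0) N i ∩ hset ν (x 1) b₁ ∩ hset ν (x 2) b₂).indicator 1 y ∂ν =
      ∫ y, (1 / 4 * (th N i (Ph ν (x 0) y) * 1 * 1) +
        (s₁ / 4 * (th N i (Ph ν (x 0) y) * hh (Ph ν (x 1) y) * 1) +
        (s₂ / 4 * (th N i (Ph ν (x 0) y) * 1 * hh (Ph ν (x 2) y)) +
        s₁ * s₂ / 4 * (th N i (Ph ν (x 0) y) * hh (Ph ν (x 1) y) * hh (Ph ν (x 2) y))))) ∂ν := by
    apply integral_congr_ae
    filter_upwards [Ph_null h _ (hx 1) (1 / 2), Ph_null h _ (hx 2) (1 / 2)] with y hy1 hy2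
    have : (sset ν (x 0) N i ∩ hset ν (x 1) b₁ ∩ hset ν (x 2) b₂).indicator (1 : Eu d → ℝ) y =
        th N i (Ph ν (x 0) y) * hb b₁ (Ph ν (x 1) y) * hb b₂ (Ph ν (x 2) y) := by
      rw [← sset_ind, ← hset_ind _ _ _ hy1, ← hset_ind _ _ _ hy2]
      by_cases a1 : y ∈ sset ν (x 0) N i <;> by_cases a2 : y ∈ hset ν (x 1) b₁ <;>
        by_cases a3 : y ∈ hset ν (x 2) b₂ <;> simp [Set.indicator, a1, a2, a3]
    rw [this]
    unfold hb
    rw [← hs₁, ← hs₂]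
    ring
  rw [e]
  have i1 := (JJ_int h hti one_nice one_nice x).const_mul (1 / 4)
  have i2 := (JJ_int h hti hh_nice one_nice x).const_mul (s₁ / 4)
  have i3 := (JJ_int h hti one_nice hh_nice x).const_mul (s₂ / 4)
  have i4 := (JJ_int h hti hh_nice hh_nice x).const_mul (s₁ * s₂ / 4)
  rw [integral_add i1 (by exact i2.add (i3.add i4)), integral_add i2 (by exact i3.add i4),
    integral_add i3 i4,
    integral_const_mul, integral_const_mul, integral_const_mul, integral_const_mul]
  unfold JJ at h1 h2 h3 h4
  rw [h1, h2, h3, h4]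
  field_simp
  ring

end Zeros

section Final
open Filter Topology MvPolynomial
variable {d : ℕ} {ν : Measure (Eu d)}

lemma nonpar {u v w : Eu d} {t : ℕ → ℝ} {s₁ s₂ : ℝ} {k : ℕ} (hk : 1 ≤ k)
    (ht : t 1 ≤ t (2 * k))
    (hne : ∀ i ≤ 2 * k, ∀ b₁ b₂ : Bool,
      (slab u t (2 * k) i ∩ halfSp v s₁ b₁ ∩ halfSp w s₂ b₂).Nonempty) :
    v ≠ u ∧ v ≠ -u ∧ w ≠ u ∧ w ≠ -u ∧ w ≠ v ∧ w ≠ -v := by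
  have lo : ∀ b₁ b₂ : Bool, ∃ x, (inner ℝ x u : ℝ) < t 1 ∧ x ∈ halfSp v s₁ b₁ ∧
      x ∈ halfSp w s₂ b₂ := by
    intro b₁ b₂
    obtain ⟨x, ⟨h1, h2⟩, h3⟩ := hne 0 (by omega) b₁ b₂
    exact ⟨x, h1.2 (by omega), h2, h3⟩
  have hi : ∀ b₁ b₂ : Bool, ∃ x, t (2 * k) < (inner ℝ x u : ℝ) ∧ x ∈ halfSp v s₁ b₁ ∧
      x ∈ halfSp w s₂ b₂ := by
    intro b₁ b₂
    obtain ⟨x, ⟨h1, h2⟩, h3⟩ := hne (2 * k) le_rfl b₁ b₂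
    exact ⟨x, h1.1 (by omega), h2, h3⟩
  have mt : ∀ (x v : Eu d) (s : ℝ), x ∈ halfSp v s true → (inner ℝ x v : ℝ) < s :=
    fun x v s h => h
  have mf : ∀ (x v : Eu d) (s : ℝ), x ∈ halfSp v s false → s < (inner ℝ x v : ℝ) :=
    fun x v s h => h
  refine ⟨?_, ?_, ?_, ?_, ?_, ?_⟩
  · rintro rfl
    obtain ⟨x, h1, h2, -⟩ := lo false true
    obtain ⟨y, h3, h4, -⟩ := hi true true
    have := mf _ _ _ h2
    have := mt _ _ _ h4
    linarith
  · rintro rfl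
    obtain ⟨x, h1, h2, -⟩ := lo true true
    obtain ⟨y, h3, h4, -⟩ := hi false true
    have a := mt _ _ _ h2
    have b := mf _ _ _ h4
    rw [inner_neg_right] at a b
    linarith
  · rintro rfl
    obtain ⟨x, h1, -, h2⟩ := lo true false
    obtain ⟨y, h3, -, h4⟩ := hi true true
    have := mf _ _ _ h2
    have := mt _ _ _ h4
    linarith
  · rintro rfl
    obtain ⟨x, h1, -, h2⟩ := lo true true
    obtain ⟨y, h3, -, h4⟩ := hi true false
    have a := mt _ _ _ h2
    have b := mf _ _ _ h4
    rw [inner_neg_right] at a b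
    linarith
  · rintro rfl
    obtain ⟨x, -, h1, h2⟩ := lo true false
    obtain ⟨y, -, h3, h4⟩ := lo false true
    have := mt _ _ _ h1
    have := mf _ _ _ h2
    have := mf _ _ _ h3
    have := mt _ _ _ h4
    linarith
  · rintro rfl
    obtain ⟨x, -, h1, h2⟩ := lo true true
    obtain ⟨y, -, h3, h4⟩ := lo false false
    have := mt _ _ _ h1
    have a := mt _ _ _ h2
    have := mf _ _ _ h3
    have b := mf _ _ _ h4
    rw [inner_neg_right] at a b
    linarith

lemma exists_levels (h : GoodM ν) (u : Eu d) (hu : u ≠ 0) (k : ℕ) :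
    ∃ t : ℕ → ℝ, StrictMonoOn t (Set.Icc 1 (2 * k)) ∧
      ∀ i ≤ 2 * k, slab u t (2 * k) i = sset ν u (2 * k + 1) i := by
  have hex : ∀ i : ℕ, ∃ t : ℝ, 1 ≤ i → i ≤ 2 * k → GG ν u t = (i : ℝ) / (2 * k + 1 : ℕ) := by
    intro i
    by_cases hi : 1 ≤ i ∧ i ≤ 2 * k
    · have h1 : (1 : ℝ) ≤ i := by exact_mod_cast hi.1
      have h2 : (i : ℝ) < (2 * k + 1 : ℕ) := by exact_mod_cast (by omega)
      have h3 : (0 : ℝ) < (2 * k + 1 : ℕ) := by positivity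
      obtain ⟨t, ht⟩ := GG_exists h u hu (c := (i : ℝ) / (2 * k + 1 : ℕ)) (by positivity)
        (by rwa [div_lt_one h3])
      exact ⟨t, fun _ _ => ht⟩
    · exact ⟨0, fun h1 h2 => absurd ⟨h1, h2⟩ hi⟩
  choose t ht using hex
  have hN : (0 : ℝ) < (2 * k + 1 : ℕ) := by positivity
  have hsm := GG_strictMono h u hu
  refine ⟨t, ?_, ?_⟩
  · intro i hi j hj hij
    rw [← hsm.lt_iff_lt, ht i hi.1 hi.2, ht j hj.1 hj.2]
    have : (i : ℝ) < j := by exact_mod_cast hij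
    gcongr
  · intro i hi
    ext x
    unfold slab sset
    rw [Set.mem_ofPred_eq, Set.mem_ofPred_eq]
    have hp := GG_pos h u hu (inner ℝ x u)
    have hl := GG_lt_one h u hu (inner ℝ x u)
    apply and_congr
    · by_cases h1 : 1 ≤ i
      · rw [← hsm.lt_iff_lt, ht i h1 hi, div_lt_iff₀' hN]
        simp only [h1, true_imp_iff]; rfl
      · have : i = 0 := by omega
        subst this
        have : (0 : ℝ) < (2 * k + 1 : ℕ) * Ph ν u x := mul_pos hN hp
        simp only [Nat.cast_zero, this, iff_true]
        intro h2
        omega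
    · by_cases h1 : i + 1 ≤ 2 * k
      · rw [← hsm.lt_iff_lt, ht (i + 1) (by omega) h1, lt_div_iff₀' hN]
        simp only [h1, true_imp_iff, Nat.cast_add, Nat.cast_one]; rfl
      · have : i = 2 * k := by omega
        subst this
        have : ((2 * k + 1 : ℕ) : ℝ) * Ph ν u x < (2 * k : ℕ) + 1 := by
          have e : ((2 * k + 1 : ℕ) : ℝ) = (2 * k : ℕ) + 1 := by push_cast; ring
          rw [← e]
          exact mul_lt_of_lt_one_right hN hl
        simp only [this, iff_true]
        intro h2
        omega

lemma exists_median (h : GoodM ν) (u : Eu d) (hu : u ≠ 0) :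
    ∃ s : ℝ, ∀ b, halfSp u s b = hset ν u b := by
  obtain ⟨s, hs⟩ := GG_exists h u hu (c := 1 / 2) (by norm_num) (by norm_num)
  have hsm := GG_strictMono h u hu
  refine ⟨s, fun b => ?_⟩
  ext x
  cases b
  · change s < inner ℝ x u ↔ 1 / 2 < GG ν u (inner ℝ x u)
    rw [← hs, hsm.lt_iff_lt]
  · change inner ℝ x u < s ↔ GG ν u (inner ℝ x u) < 1 / 2
    rw [← hs, hsm.lt_iff_lt]

lemma core (h : GoodM ν) (k : ℕ) (hk : 1 ≤ k) (hd : 0 < d)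
    (hQ : (X 1 + X 2) *
        (X 1 * X 2 * (X 0 + X 1) * (X 0 + X 2) * (X 1 + X 2) * (X 0 + X 1 + X 2)) ^ k ∉
      Ideal.span {(X 0 : MvPolynomial (Fin 3) (ZMod 2)) ^ d, X 1 ^ d, X 2 ^ d}) :
    ∃ (u v w : Eu d) (t : ℕ → ℝ) (s₁ s₂ : ℝ),
      ‖u‖ = 1 ∧ ‖v‖ = 1 ∧ ‖w‖ = 1 ∧
      v ≠ u ∧ v ≠ -u ∧ w ≠ u ∧ w ≠ -u ∧ w ≠ v ∧ w ≠ -v ∧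
      StrictMonoOn t (Set.Icc 1 (2 * k)) ∧
      ∀ i ≤ 2 * k, ∀ b₁ b₂ : Bool,
        ν.real (slab u t (2 * k) i ∩ halfSp v s₁ b₁ ∩ halfSp w s₂ b₂) =
          1 / (4 * (2 * k + 1 : ℕ)) := by
  have := h.prob
  obtain ⟨n, hn, hc⟩ := exists_coeff _ d hQ
  obtain ⟨x, hx, hz⟩ := exists_good h k hd n hn hc
  have hnp : ∀ j, 0 < ‖x j‖⁻¹ := fun j => inv_pos.2 (norm_pos_iff.2 (hx j))
  have hn1 : ∀ j, ‖(‖x j‖⁻¹ • x j)‖ = 1 := fun j => by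
    rw [norm_smul, norm_inv, norm_norm, inv_mul_cancel₀ (norm_ne_zero_iff.2 (hx j))]
  have hne : ∀ j, ‖x j‖⁻¹ • x j ≠ 0 := fun j => smul_ne_zero (hnp j).ne' (hx j)
  have hPh : ∀ j, Ph ν (‖x j‖⁻¹ • x j) = Ph ν (x j) := fun j => Ph_smul _ _ (hnp j)
  obtain ⟨t, htm, ht⟩ := exists_levels h _ (hne 0) k
  obtain ⟨s₁, hs₁⟩ := exists_median h _ (hne 1)
  obtain ⟨s₂, hs₂⟩ := exists_median h _ (hne 2)
  have hbox : ∀ i ≤ 2 * k, ∀ b₁ b₂ : Bool,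
        ν.real (slab (‖x 0‖⁻¹ • x 0) t (2 * k) i ∩ halfSp (‖x 1‖⁻¹ • x 1) s₁ b₁ ∩
          halfSp (‖x 2‖⁻¹ • x 2) s₂ b₂) = 1 / (4 * (2 * k + 1 : ℕ)) := by
    intro i hi b₁ b₂
    obtain ⟨h1, h2, h3, h4⟩ := hz i hi
    rw [ht i hi, hs₁, hs₂, ← box_meas h (N := 2 * k + 1) (by omega) x hx h1 h2 h3 h4 b₁ b₂]
    unfold sset hset
    simp only [hPh]
  have hnon : ∀ i ≤ 2 * k, ∀ b₁ b₂ : Bool, (slab (‖x 0‖⁻¹ • x 0) t (2 * k) i ∩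
      halfSp (‖x 1‖⁻¹ • x 1) s₁ b₁ ∩ halfSp (‖x 2‖⁻¹ • x 2) s₂ b₂).Nonempty := by
    intro i hi b₁ b₂
    rw [Set.nonempty_iff_ne_empty]
    intro e
    have := hbox i hi b₁ b₂
    rw [e, measureReal_empty] at this
    have h3 : (0 : ℝ) < 1 / (4 * (2 * k + 1 : ℕ)) := by positivity
    linarith
  obtain ⟨p1, p2, p3, p4, p5, p6⟩ := nonpar hk
    (htm.monotoneOn ⟨le_rfl, by omega⟩ ⟨by omega, le_rfl⟩ (by omega)) hnon
  exact ⟨_, _, _, t, s₁, s₂, hn1 0, hn1 1, hn1 2, p1, p2, p3, p4, p5, p6, htm, hbox⟩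

lemma vol_null (u : Eu d) (hu : u ≠ 0) (t : ℝ) :
    (volume : Measure (Eu d)) {x | inner ℝ x u = t} = 0 := by
  have hu2 : (inner ℝ u u : ℝ) ≠ 0 := by simpa using hu
  have e : {x : Eu d | inner ℝ x u = t} =
      (fun x => x + (-((t / inner ℝ u u) • u))) ⁻¹' ((Submodule.span ℝ {u})ᗮ : Set (Eu d)) := by
    ext x
    rw [Set.mem_preimage, SetLike.mem_coe, Submodule.mem_orthogonal_singleton_iff_inner_left,
      inner_add_left, inner_neg_left, inner_smul_left, RCLike.conj_to_real,
      div_mul_cancel₀ _ hu2, Set.mem_ofPred_eq]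
    constructor <;> intro h <;> linarith
  rw [e, measure_preimage_add_right]
  apply Measure.addHaar_submodule
  intro htop
  have : u ∈ (Submodule.span ℝ {u})ᗮ := by rw [htop]; trivial
  rw [Submodule.mem_orthogonal_singleton_iff_inner_left] at this
  exact hu2 this

lemma final (hd : 0 < d) (k : ℕ) (hk : 1 ≤ k)
    (hQ : (X 1 + X 2) *
        (X 1 * X 2 * (X 0 + X 1) * (X 0 + X 2) * (X 1 + X 2) * (X 0 + X 1 + X 2)) ^ k ∉
      Ideal.span {(X 0 : MvPolynomial (Fin 3) (ZMod 2)) ^ d, X 1 ^ d, X 2 ^ d})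
    (μ : Measure (Eu d)) (f : Eu d → ℝ)
    (hμ : ∀ A : Set (Eu d), MeasurableSet A → μ A = ENNReal.ofReal (∫ x in A, f x))
    (hpos : ∀ U : Set (Eu d), IsOpen U → U.Nonempty → 0 < μ U) :
    ∃ (u v w : Eu d) (t : ℕ → ℝ) (s₁ s₂ : ℝ),
      ‖u‖ = 1 ∧ ‖v‖ = 1 ∧ ‖w‖ = 1 ∧
      v ≠ u ∧ v ≠ -u ∧ w ≠ u ∧ w ≠ -u ∧ w ≠ v ∧ w ≠ -v ∧
      StrictMonoOn t (Set.Icc 1 (2 * k)) ∧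
      ∀ i ≤ 2 * k, ∀ b₁ b₂ : Bool,
        μ (slab u t (2 * k) i ∩ halfSp v s₁ b₁ ∩ halfSp w s₂ b₂) =
          μ Set.univ / ((4 * (2 * k + 1) : ℕ) : ENNReal) := by
  have hfin : μ Set.univ ≠ ⊤ := by rw [hμ _ MeasurableSet.univ]; exact ENNReal.ofReal_ne_top
  have h0 : μ Set.univ ≠ 0 := (hpos _ isOpen_univ ⟨0, trivial⟩).ne'
  have hg : GoodM ((μ Set.univ)⁻¹ • μ) := by
    refine ⟨⟨?_⟩, ?_, ?_⟩
    · rw [Measure.smul_apply, smul_eq_mul, ENNReal.inv_mul_cancel h0 hfin]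
    · intro u hu t
      rw [Measure.smul_apply, smul_eq_mul, hμ {x | inner ℝ x u = t},
        setIntegral_measure_zero _ (vol_null u hu t)]
      · simp
      · exact (isClosed_eq (by fun_prop) continuous_const).measurableSet
    · intro U hU hne
      rw [Measure.smul_apply, smul_eq_mul]
      exact ENNReal.mul_pos (ENNReal.inv_ne_zero.2 hfin) (hpos U hU hne).ne'
  have := hg.prob
  obtain ⟨u, v, w, t, s₁, s₂, a1, a2, a3, a4, a5, a6, a7, a8, a9, a10, hb⟩ := core hg k hk hd hQ
  refine ⟨u, v, w, t, s₁, s₂, a1, a2, a3, a4, a5, a6, a7, a8, a9, a10, fun i hi b₁ b₂ => ?_⟩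
  have hb := hb i hi b₁ b₂
  have e := ofReal_measureReal (μ := (μ Set.univ)⁻¹ • μ)
    (s := slab u t (2 * k) i ∩ halfSp v s₁ b₁ ∩ halfSp w s₂ b₂) (measure_ne_top _ _)
  rw [hb, Measure.smul_apply, smul_eq_mul] at e
  set B := slab u t (2 * k) i ∩ halfSp v s₁ b₁ ∩ halfSp w s₂ b₂
  have e2 : μ B = μ Set.univ * ((μ Set.univ)⁻¹ * μ B) := by
    rw [← mul_assoc, ENNReal.mul_inv_cancel h0 hfin, one_mul]
  rw [e2, ← e, div_eq_mul_inv]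
  congr 1
  rw [one_mul, ENNReal.ofReal_inv_of_pos (by positivity)]
  congr 1
  rw [← ENNReal.ofReal_natCast]
  congr 1
  push_cast
  ring

end Final

end EqP

open MvPolynomial in
/-- If `(x₂+x₃)·(𝔓₃/x₁)^k ∉ (x₁^d, x₂^d, x₃^d)` in `(ℤ/2)[x₁,x₂,x₃]`, then every
mass distribution in `ℝ^d` admits an equipartition into `(2k+1)×2×2` boxes by
`2k` parallel hyperplanes and two additional non-parallel hyperplanes. -/
theorem equipartition_three_directions_even (d k : ℕ) (hd : 3 ≤ d) (hk : 1 ≤ k)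
    (hQ : (X 1 + X 2) *
        (X 1 * X 2 * (X 0 + X 1) * (X 0 + X 2) * (X 1 + X 2) * (X 0 + X 1 + X 2)) ^ k ∉
      Ideal.span {(X 0 : MvPolynomial (Fin 3) (ZMod 2)) ^ d, X 1 ^ d, X 2 ^ d})
    (μ : Measure (EuclideanSpace ℝ (Fin d)))
    (f : EuclideanSpace ℝ (Fin d) → ℝ) (hf : Integrable f)
    (hμ : ∀ A : Set (EuclideanSpace ℝ (Fin d)), MeasurableSet A →
      μ A = ENNReal.ofReal (∫ x in A, f x))
    (hpos : ∀ U : Set (EuclideanSpace ℝ (Fin d)), IsOpen U → U.Nonempty → 0 < μ U) :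
    ∃ (u v w : EuclideanSpace ℝ (Fin d)) (t : ℕ → ℝ) (s₁ s₂ : ℝ),
      ‖u‖ = 1 ∧ ‖v‖ = 1 ∧ ‖w‖ = 1 ∧
      v ≠ u ∧ v ≠ -u ∧ w ≠ u ∧ w ≠ -u ∧ w ≠ v ∧ w ≠ -v ∧
      StrictMonoOn t (Set.Icc 1 (2 * k)) ∧
      ∀ i ≤ 2 * k, ∀ b₁ b₂ : Bool,
        μ (slab u t (2 * k) i ∩ halfSp v s₁ b₁ ∩ halfSp w s₂ b₂) =
          μ Set.univ / ((4 * (2 * k + 1) : ℕ) : ENNReal) := by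
  exact EqP.final (by omega) k hk hQ μ f hμ hpos
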